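/- arXiv:2603.19696 — 9 statements merged into one kernel-verified Lean document; each statement's English description precedes it below -/
import Mathlib

section
/- Let 1 < p ≤ q be real exponents, a₀ ≥ 0, and let H(t) = t^p + a₀·t^q with H'(t) = p·t^{p−1} + a₀·q·t^{q−1}. Let N, n ≥ 1 and let f : ℝ^{N×n} → ℝ be continuously differentiable with gradient ∂f (with respect to the Frobenius inner product). Let δ > 0 and κ > 0 and suppose that for every P ∈ ℝ^{N×n} with 0 < |P| < κ one has |H'(|P|)·P/|P| − ∂f(P)| < δ·H'(|P|). Then for every P ∈ ℝ^{N×n} with 0 < |P| < κ one has |H(|P|) − f(P) + f(0)| < δ·H(|P|). -/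
open Set in
/-- If the gradient of `f` is `δ * H'(‖Q‖)`-close to the gradient of the radial function `H(‖·‖)` on
a punctured ball, then `f - f 0` is `δ * H(‖·‖)`-close to `H(‖·‖)` there. -/
theorem abs_radial_sub_lt_of_norm_gradient_sub_lt {E : Type*} [NormedAddCommGroup E]
    [InnerProductSpace ℝ E] [CompleteSpace E] {f : E → ℝ} (hf : Differentiable ℝ f)
    {H H' : ℝ → ℝ} (hH : ContinuousOn H (Ici 0)) (hH₀ : H 0 = 0)
    (hH' : ∀ t, 0 < t → HasDerivAt H (H' t) t) {δ κ : ℝ}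
    (hyp : ∀ Q : E, 0 < ‖Q‖ → ‖Q‖ < κ →
      ‖(H' ‖Q‖ / ‖Q‖) • Q - gradient f Q‖ < δ * H' ‖Q‖)
    {P : E} (hP : 0 < ‖P‖) (hPκ : ‖P‖ < κ) :
    |H ‖P‖ - f P + f 0| < δ * H ‖P‖ := by
  set r := ‖P‖
  obtain ⟨e, he, hPe⟩ : ∃ e : E, ‖e‖ = 1 ∧ r • e = P :=
    ⟨r⁻¹ • P, by rw [norm_smul, norm_inv, norm_norm, inv_mul_cancel₀ hP.ne'],
      smul_inv_smul₀ hP.ne' P⟩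
  have hfd (t : ℝ) : HasDerivAt (fun s : ℝ => f (s • e)) (inner ℝ (gradient f (t • e)) e) t := by
    have h := (hf (t • e)).hasGradientAt.hasFDerivAt.comp_hasDerivAt t
      ((hasDerivAt_id t).smul_const e)
    simpa [Function.comp_def] using h
  have hbound (t : ℝ) (ht : t ∈ Ioo 0 r) :
      |H' t - inner ℝ (gradient f (t • e)) e| < δ * H' t := by
    have hn : ‖t • e‖ = t := by rw [norm_smul, he, mul_one, Real.norm_of_nonneg ht.1.le]
    have h := hyp (t • e) (by rw [hn]; exact ht.1) (by rw [hn]; exact ht.2.trans hPκ)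
    rw [hn, smul_smul, div_mul_cancel₀ _ ht.1.ne'] at h
    refine lt_of_le_of_lt ?_ h
    have h₁ := abs_real_inner_le_norm (H' t • e - gradient f (t • e)) e
    rwa [inner_sub_left, real_inner_smul_left, real_inner_self_eq_norm_sq, he, one_pow, mul_one,
      mul_one] at h₁
  have hHc : ContinuousOn H (Icc 0 r) := hH.mono Icc_subset_Ici_self
  have hfc : ContinuousOn (fun s : ℝ => f (s • e)) (Icc 0 r) := fun t _ =>
    (hfd t).continuousAt.continuousWithinAt
  have increment (σ : ℝ) (hσ : |σ| = 1) : σ * (H r - f P + f 0) < δ * H r := by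
    have hmono : StrictMonoOn (fun t => δ * H t - σ * (H t - f (t • e))) (Icc 0 r) := by
      refine strictMonoOn_of_deriv_pos (convex_Icc 0 r)
        ((hHc.const_mul δ).sub ((hHc.sub hfc).const_mul σ)) fun t ht => ?_
      rw [interior_Icc] at ht
      have hd := ((hH' t ht.1).const_mul δ).sub (((hH' t ht.1).sub (hfd t)).const_mul σ)
      have hderiv : deriv (fun t => δ * H t - σ * (H t - f (t • e))) t =
          δ * H' t - σ * (H' t - inner ℝ (gradient f (t • e)) e) := hd.deriv
      rw [hderiv, sub_pos]
      refine (le_abs_self _).trans_lt ?_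
      rw [abs_mul, hσ, one_mul]
      exact hbound t ht
    have h := hmono (left_mem_Icc.2 hP.le) (right_mem_Icc.2 hP.le) hP
    simp only [hH₀, zero_smul, hPe] at h
    linarith
  have h₁ := increment 1 (by simp)
  have h₂ := increment (-1) (by simp)
  exact abs_lt.2 ⟨by linarith, by linarith⟩

/-- If the gradient of `f` approximates the gradient field of the double
phase function `H(t) = t^p + a₀ t^q` for small `P`, then `f(P) - f(0)` approximates
`H(|P|)` for small `P`. -/
theorem stmt_0 (N n : ℕ) (hN : 1 ≤ N) (hn : 1 ≤ n)
    (p q a₀ : ℝ) (hp : 1 < p) (hpq : p ≤ q) (ha₀ : 0 ≤ a₀)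
    (f : EuclideanSpace ℝ (Fin N × Fin n) → ℝ) (hf : ContDiff ℝ 1 f)
    (δ κ : ℝ) (hδ : 0 < δ) (hκ : 0 < κ)
    (hyp : ∀ P : EuclideanSpace ℝ (Fin N × Fin n), 0 < ‖P‖ → ‖P‖ < κ →
      ‖((p * ‖P‖ ^ (p - 1) + a₀ * q * ‖P‖ ^ (q - 1)) / ‖P‖) • P - gradient f P‖
        < δ * (p * ‖P‖ ^ (p - 1) + a₀ * q * ‖P‖ ^ (q - 1))) :
    ∀ P : EuclideanSpace ℝ (Fin N × Fin n), 0 < ‖P‖ → ‖P‖ < κ →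
      |(‖P‖ ^ p + a₀ * ‖P‖ ^ q) - f P + f 0| < δ * (‖P‖ ^ p + a₀ * ‖P‖ ^ q) := by
  intro P hP hPκ
  have hq : 1 < q := hp.trans_le hpq
  refine abs_radial_sub_lt_of_norm_gradient_sub_lt (H := fun t => t ^ p + a₀ * t ^ q)
    (H' := fun t => p * t ^ (p - 1) + a₀ * q * t ^ (q - 1)) (hf.differentiable one_ne_zero)
    ?_ ?_ (fun t ht => ?_) hyp hP hPκ
  · exact ((Real.continuous_rpow_const (by linarith)).add
      ((Real.continuous_rpow_const (by linarith)).const_mul a₀)).continuousOn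
  · simp [Real.zero_rpow (zero_lt_one.trans hp).ne', Real.zero_rpow (zero_lt_one.trans hq).ne']
  · rw [mul_assoc]
    exact (Real.hasDerivAt_rpow_const (Or.inl ht.ne')).add
      ((Real.hasDerivAt_rpow_const (Or.inl ht.ne')).const_mul a₀)
end

section
/- Let n ≥ 2, N ≥ 1, 1 < p ≤ q, a₀ ≥ 0, ν > 0, and let H(t) = t^p + a₀·t^q with H''(t) = p(p−1)·t^{p−2} + a₀·q(q−1)·t^{q−2}. Let f : ℝ^{N×n} → ℝ be C¹ on ℝ^{N×n} and C² on ℝ^{N×n}∖{0}, with Hessian ∂²f. Suppose f is uniformly quasiconvex in the sense that for every P ∈ ℝ^{N×n}, every open ball B ⊂ ℝⁿ, and every smooth compactly supported ζ : B → ℝ^N, ∫_B (f(P + Dζ(x)) − f(P)) dx ≥ ν·∫_B H''(|P| + |Dζ(x)|)·|Dζ(x)|² dx, where Dζ(x) ∈ ℝ^{N×n} is the derivative of ζ at x and the integrand on the right is interpreted as 0 at points where |P| + |Dζ(x)| = 0. Then there exists a constant c > 0, depending only on n, N, p, q, ν, such that for every P ∈ ℝ^{N×n}∖{0}, every b ∈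 ℝ^N, and every z ∈ ℝⁿ: ⟨∂²f(P)(b⊗z) | b⊗z⟩ ≥ c·H''(|P|)·|b|²·|z|², where b⊗z ∈ ℝ^{N×n} is the matrix with entries (b^i·z_j). -/
open MeasureTheory

/-- The derivative of `ζ : ℝⁿ → ℝᴺ` at `x`, viewed as an `N × n` matrix (an element of
`EuclideanSpace ℝ (Fin N × Fin n)`, i.e. with the Frobenius norm): its `(i,j)` entry is
`∂ζⁱ/∂xⱼ (x)`. -/
noncomputable def matDeriv {n N : ℕ}
    (ζ : EuclideanSpace ℝ (Fin n) → EuclideanSpace ℝ (Fin N))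
    (x : EuclideanSpace ℝ (Fin n)) : EuclideanSpace ℝ (Fin N × Fin n) :=
  (WithLp.equiv 2 ((Fin N × Fin n) → ℝ)).symm
    fun ij => fderiv ℝ ζ x (EuclideanSpace.single ij.2 1) ij.1

/-- The rank-one matrix `b ⊗ z` with entries `bⁱ · zⱼ`. -/
noncomputable def tensorMat {n N : ℕ} (b : EuclideanSpace ℝ (Fin N))
    (z : EuclideanSpace ℝ (Fin n)) : EuclideanSpace ℝ (Fin N × Fin n) :=
  (WithLp.equiv 2 ((Fin N × Fin n) → ℝ)).symm fun ij => b ij.1 * z ij.2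

/-- If `f` is differentiable and twice differentiable at `P`, its symmetric second difference
at `P` is bounded above by the Hessian up to an arbitrarily small quadratic error. -/
theorem exists_forall_symmetric_difference_le {E : Type*} [NormedAddCommGroup E]
    [NormedSpace ℝ E] {f : E → ℝ} (hf : Differentiable ℝ f) {P : E}
    (h2 : DifferentiableAt ℝ (fderiv ℝ f) P) {ε : ℝ} (hε : 0 < ε) :
    ∃ δ : ℝ, 0 < δ ∧ ∀ M : E, ‖M‖ < δ →
      f (P + M) + f (P - M) - 2 * f P ≤ fderiv ℝ (fderiv ℝ f) P M M + ε * ‖M‖ ^ 2 := by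
  set A := fderiv ℝ (fderiv ℝ f) P with hA
  obtain ⟨δ, hδ, hball⟩ := Metric.eventually_nhds_iff.1
    (h2.hasFDerivAt.isLittleO.def hε)
  have key : ∀ X : E, ‖X‖ < δ → ‖fderiv ℝ f (P + X) - fderiv ℝ f P - A X‖ ≤ ε * ‖X‖ := by
    intro X hX
    simpa using hball (y := P + X) (by simpa [dist_eq_norm] using hX)
  refine ⟨δ, hδ, fun M hM => ?_⟩
  let ψ : ℝ → ℝ := fun s => f (P + s • M) + f (P - s • M) - s ^ 2 * (A M M + ε * ‖M‖ ^ 2)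
  have hψ : ∀ s, HasDerivAt ψ (fderiv ℝ f (P + s • M) M - fderiv ℝ f (P - s • M) M
      - 2 * s * (A M M + ε * ‖M‖ ^ 2)) s := by
    intro s
    have h1 : HasDerivAt (fun s : ℝ => P + s • M) M s := by
      simpa using ((hasDerivAt_id s).smul_const M).const_add P
    have h3 : HasDerivAt (fun s : ℝ => P - s • M) (-M) s := by
      simpa using ((hasDerivAt_id s).smul_const M).const_sub P
    have e1 := (hf (P + s • M)).hasFDerivAt.comp_hasDerivAt s h1
    have e2 := (hf (P - s • M)).hasFDerivAt.comp_hasDerivAt s h3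
    have e3 := ((hasDerivAt_pow 2 s).mul_const (A M M + ε * ‖M‖ ^ 2))
    refine ((e1.add e2).sub e3).congr_deriv ?_
    simp [sub_eq_add_neg]
  have hanti : AntitoneOn ψ (Set.Icc 0 1) := by
    refine antitoneOn_of_deriv_nonpos (convex_Icc 0 1)
      (fun s _ => (hψ s).continuousAt.continuousWithinAt)
      (fun s _ => (hψ s).differentiableAt.differentiableWithinAt) ?_
    intro s hs
    rw [interior_Icc] at hs
    rw [(hψ s).deriv]
    have hsM : ‖s • M‖ = s * ‖M‖ := by rw [norm_smul, Real.norm_of_nonneg hs.1.le]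
    have hlt : ‖s • M‖ < δ := by
      rw [hsM]
      nlinarith [norm_nonneg M, hs.1, hs.2]
    have k1 := key (s • M) hlt
    have k2 := key (-(s • M)) (by rwa [norm_neg])
    have l1 := (abs_le.1 (((fderiv ℝ f (P + s • M) - fderiv ℝ f P - A (s • M)).le_of_opNorm_le
      k1 M))).2
    have l2 := (abs_le.1 (((fderiv ℝ f (P + -(s • M)) - fderiv ℝ f P
      - A (-(s • M))).le_of_opNorm_le k2 M))).1
    rw [norm_neg] at l2
    rw [hsM] at l1 l2
    simp only [map_neg, map_smul, sub_apply, neg_apply,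
      smul_apply, smul_eq_mul, ← sub_eq_add_neg] at l1 l2
    nlinarith
  have := hanti (Set.left_mem_Icc.2 zero_le_one) (Set.right_mem_Icc.2 zero_le_one) zero_le_one
  simp only [ψ, one_smul, zero_smul, add_zero, sub_zero] at this
  linarith

section
variable {n N : ℕ}

theorem continuous_matDeriv {ζ : EuclideanSpace ℝ (Fin n) → EuclideanSpace ℝ (Fin N)}
    (hζ : ContDiff ℝ 1 ζ) : Continuous (matDeriv ζ) := by
  have h := hζ.continuous_fderiv one_ne_zero
  refine (PiLp.continuous_toLp 2 _).comp (continuous_pi fun ij => ?_)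
  have h1 : Continuous fun x => fderiv ℝ ζ x (EuclideanSpace.single ij.2 1) :=
    h.clm_apply continuous_const
  fun_prop

theorem matDeriv_const_smul {ζ : EuclideanSpace ℝ (Fin n) → EuclideanSpace ℝ (Fin N)}
    (hζ : Differentiable ℝ ζ) (t : ℝ) (x : EuclideanSpace ℝ (Fin n)) :
    matDeriv (fun y => t • ζ y) x = t • matDeriv ζ x := by
  ext ij
  simp [matDeriv, fderiv_fun_const_smul (hζ x)]

theorem matDeriv_smul_const {u : EuclideanSpace ℝ (Fin n) → ℝ} {x g : EuclideanSpace ℝ (Fin n)}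
    (hu : HasGradientAt u g x) (b : EuclideanSpace ℝ (Fin N)) :
    matDeriv (fun y => u y • b) x = tensorMat b g := by
  ext ij
  have h := (hu.hasFDerivAt.smul_const b).fderiv
  simp [matDeriv, tensorMat, h, mul_comm, EuclideanSpace.inner_single_right]

theorem tensorMat_add (b : EuclideanSpace ℝ (Fin N)) (v w : EuclideanSpace ℝ (Fin n)) :
    tensorMat b (v + w) = tensorMat b v + tensorMat b w := by
  ext ij
  simp [tensorMat, mul_add]

theorem tensorMat_smul (b : EuclideanSpace ℝ (Fin N)) (t : ℝ) (v : EuclideanSpace ℝ (Fin n)) :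
    tensorMat b (t • v) = t • tensorMat b v := by
  ext ij
  simp [tensorMat, mul_left_comm]

theorem norm_tensorMat_sq (b : EuclideanSpace ℝ (Fin N)) (v : EuclideanSpace ℝ (Fin n)) :
    ‖tensorMat b v‖ ^ 2 = ‖b‖ ^ 2 * ‖v‖ ^ 2 := by
  simp only [EuclideanSpace.norm_sq_eq, Real.norm_eq_abs, sq_abs, tensorMat,
    Finset.sum_mul_sum, Fintype.sum_prod_type]
  simp [mul_pow]

theorem Continuous.integrableOn_ball {E F : Type*} [MetricSpace E] [ProperSpace E]
    [MeasurableSpace E] [OpensMeasurableSpace E] [NormedAddCommGroup F]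
    {μ : Measure E} [IsFiniteMeasureOnCompacts μ] {g : E → F} (hg : Continuous g) {x₀ : E}
    {r : ℝ} : IntegrableOn g (Metric.ball x₀ r) μ :=
  (hg.continuousOn.integrableOn_compact (isCompact_closedBall x₀ r)).mono_set
    Metric.ball_subset_closedBall

/-- Testing uniform quasiconvexity at `P` with small multiples of `ζ` and `-ζ` gives the
corresponding integral inequality for the Hessian at `P`. -/
theorem integral_hessian_ge {f : EuclideanSpace ℝ (Fin N × Fin n) → ℝ} (hf : ContDiff ℝ 1 f)
    {P : EuclideanSpace ℝ (Fin N × Fin n)} (hP : P ≠ 0)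
    (h2 : DifferentiableAt ℝ (fderiv ℝ f) P) {κ : ℝ → ℝ} (hκ : ContinuousOn κ (Set.Ioi 0))
    {ν : ℝ} (hν : 0 < ν) {x₀ : EuclideanSpace ℝ (Fin n)} {r : ℝ}
    (hq : ∀ ζ : EuclideanSpace ℝ (Fin n) → EuclideanSpace ℝ (Fin N),
      ContDiff ℝ (⊤ : ℕ∞) ζ → tsupport ζ ⊆ Metric.ball x₀ r →
      ν * ∫ x in Metric.ball x₀ r, κ (‖P‖ + ‖matDeriv ζ x‖) * ‖matDeriv ζ x‖ ^ 2
        ≤ ∫ x in Metric.ball x₀ r, (f (P + matDeriv ζ x) - f P))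
    {ζ : EuclideanSpace ℝ (Fin n) → EuclideanSpace ℝ (Fin N)}
    (hζ : ContDiff ℝ (⊤ : ℕ∞) ζ) (hsupp : tsupport ζ ⊆ Metric.ball x₀ r) :
    2 * ν * κ ‖P‖ * ∫ x in Metric.ball x₀ r, ‖matDeriv ζ x‖ ^ 2
      ≤ ∫ x in Metric.ball x₀ r,
        fderiv ℝ (fderiv ℝ f) P (matDeriv ζ x) (matDeriv ζ x) := by
  have hP' : 0 < ‖P‖ := norm_pos_iff.2 hP
  set A := fderiv ℝ (fderiv ℝ f) P with hA
  have hζ1 : ContDiff ℝ 1 ζ := hζ.of_le (by exact_mod_cast le_top)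
  have hD : Continuous (matDeriv ζ) := continuous_matDeriv hζ1
  obtain ⟨C, hC⟩ := (isCompact_closedBall x₀ r).exists_bound_of_continuousOn hD.continuousOn
  set I := ∫ x in Metric.ball x₀ r, ‖matDeriv ζ x‖ ^ 2 with hI
  have hI0 : 0 ≤ I := integral_nonneg fun x => by positivity
  have claim : ∀ ε : ℝ, 0 < ε → 2 * ν * (κ ‖P‖ - ε) * I
      ≤ (∫ x in Metric.ball x₀ r, A (matDeriv ζ x) (matDeriv ζ x)) + ε * I := by
    intro ε hε
    obtain ⟨δ₁, hδ₁, hT⟩ :=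
      exists_forall_symmetric_difference_le (hf.differentiable one_ne_zero) h2 hε
    obtain ⟨δ₂, hδ₂, hK⟩ := Metric.continuousAt_iff.1
      (hκ.continuousAt (Ioi_mem_nhds hP')) ε hε
    set t : ℝ := min δ₁ δ₂ / (|C| + 1) with ht
    have ht0 : 0 < t := by positivity
    have hsmall : ∀ x ∈ Metric.ball x₀ r, ‖t • matDeriv ζ x‖ < min δ₁ δ₂ := by
      intro x hx
      have h1 := (hC x (Metric.ball_subset_closedBall hx)).trans (le_abs_self C)
      rw [norm_smul, Real.norm_of_nonneg ht0.le, ht, div_mul_eq_mul_div, div_lt_iff₀ (by positivity)]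
      have : 0 < min δ₁ δ₂ := by positivity
      nlinarith
    have hbase : ∀ s : ℝ, |s| = t →
        ν * ∫ x in Metric.ball x₀ r, κ (‖P‖ + ‖t • matDeriv ζ x‖) * ‖t • matDeriv ζ x‖ ^ 2
        ≤ ∫ x in Metric.ball x₀ r, (f (P + s • matDeriv ζ x) - f P) := by
      intro s hs
      have := hq (fun y => s • ζ y) (hζ.const_smul s)
        ((tsupport_smul_subset_right (fun _ => s) ζ).trans hsupp)
      simp only [matDeriv_const_smul (hζ1.differentiable one_ne_zero)] at this
      have hn : ∀ x, ‖s • matDeriv ζ x‖ = ‖t • matDeriv ζ x‖ := fun x => by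
        rw [norm_smul, norm_smul, Real.norm_eq_abs, hs, Real.norm_of_nonneg ht0.le]
      simpa only [hn] using this
    have b1 := hbase t (abs_of_pos ht0)
    have b2 := hbase (-t) (by rw [abs_neg, abs_of_pos ht0])
    have hfc := hf.continuous
    have hAc : Continuous fun x => A (matDeriv ζ x) (matDeriv ζ x) :=
      (A.continuous.comp hD).clm_apply hD
    have hκc : Continuous fun x => κ (‖P‖ + ‖t • matDeriv ζ x‖) := by
      refine hκ.comp_continuous (by fun_prop) fun x => ?_
      exact add_pos_of_pos_of_nonneg hP' (norm_nonneg _)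
    have hlow : (κ ‖P‖ - ε) * (t ^ 2 * I) ≤
        ∫ x in Metric.ball x₀ r, κ (‖P‖ + ‖t • matDeriv ζ x‖) * ‖t • matDeriv ζ x‖ ^ 2 := by
      rw [hI, ← integral_const_mul, ← integral_const_mul]
      refine setIntegral_mono_on (Continuous.integrableOn_ball (by fun_prop)) (Continuous.integrableOn_ball (hκc.mul (by fun_prop)))
        measurableSet_ball fun x hx => ?_
      have h1 := hK (x := ‖P‖ + ‖t • matDeriv ζ x‖) (by
        simpa [Real.dist_eq] using (hsmall x hx).trans_le (min_le_right _ _))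
      rw [Real.dist_eq] at h1
      have h3 := (abs_lt.1 h1).1
      rw [← sq_abs t, ← mul_pow, ← Real.norm_eq_abs, ← norm_smul]
      exact mul_le_mul_of_nonneg_right (by linarith) (by positivity)
    have hup : (∫ x in Metric.ball x₀ r, (f (P + t • matDeriv ζ x) - f P))
        + (∫ x in Metric.ball x₀ r, (f (P + -t • matDeriv ζ x) - f P))
        ≤ t ^ 2 * ((∫ x in Metric.ball x₀ r, A (matDeriv ζ x) (matDeriv ζ x)) + ε * I) := by
      rw [hI, ← integral_const_mul, ← integral_add (Continuous.integrableOn_ball (by fun_prop)) (Continuous.integrableOn_ball (by fun_prop)),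
        ← integral_add (Continuous.integrableOn_ball hAc) (Continuous.integrableOn_ball (by fun_prop)), ← integral_const_mul]
      refine setIntegral_mono_on (Continuous.integrableOn_ball (by fun_prop))
        (Continuous.integrableOn_ball (continuous_const.mul (hAc.add (by fun_prop)))) measurableSet_ball fun x hx => ?_
      have h1 := hT _ ((hsmall x hx).trans_le (min_le_left _ _))
      rw [norm_smul, mul_pow, Real.norm_eq_abs, sq_abs] at h1
      simp only [map_smul, smul_apply, smul_eq_mul] at h1
      rw [neg_smul, ← sub_eq_add_neg]
      linarith
    have h3 := mul_le_mul_of_nonneg_left hlow hν.le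
    refine le_of_mul_le_mul_left ?_ (pow_pos ht0 2)
    linarith
  refine le_of_forall_pos_le_add fun η hη => ?_
  clear_value I A
  have hden : 0 < (2 * ν + 1) * I + 1 := by positivity
  have h1 := claim (η / ((2 * ν + 1) * I + 1)) (by positivity)
  have h3 : η / ((2 * ν + 1) * I + 1) * ((2 * ν + 1) * I) ≤ η := by
    rw [div_mul_eq_mul_div, div_le_iff₀ hden]
    nlinarith
  linarith

/-- A quadratic form on gradients whose integral against every compactly supported `u` is
nonnegative is nonnegative: test with `η cos (k⟪z, ·⟫)` and `η sin (k⟪z, ·⟫)` and let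
`k → ∞`. -/
theorem bilin_nonneg_of_integral_gradient_nonneg {E : Type*} [NormedAddCommGroup E]
    [InnerProductSpace ℝ E] [FiniteDimensional ℝ E] [MeasurableSpace E] [BorelSpace E]
    (μ : Measure E) [IsFiniteMeasureOnCompacts μ] [μ.IsOpenPosMeasure]
    (Q : E →L[ℝ] E →L[ℝ] ℝ) {x₀ : E} {r : ℝ} (hr : 0 < r)
    (hQ : ∀ (u : E → ℝ) (g : E → E), ContDiff ℝ (⊤ : ℕ∞) u → tsupport u ⊆ Metric.ball x₀ r →
      (∀ x, HasGradientAt u (g x) x) →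
      0 ≤ ∫ x in Metric.ball x₀ r, Q (g x) (g x) ∂μ) (z : E) : 0 ≤ Q z z := by
  let η : ContDiffBump x₀ := ⟨r / 4, r / 2, by linarith, by linarith⟩
  have hη : ContDiff ℝ (⊤ : ℕ∞) η := η.contDiff
  have hηs : tsupport η ⊆ Metric.ball x₀ r := by
    rw [η.tsupport_eq]
    exact Metric.closedBall_subset_ball (by simp only [η]; linarith)
  have hη' : ∀ x, HasGradientAt η (gradient η x) x := fun x =>
    (hη.differentiable (by simp) x).hasGradientAt
  have hgc : Continuous (gradient η) :=
    (InnerProductSpace.toDual ℝ E).symm.continuous.comp (hη.continuous_fderiv (by simp))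
  have hηc : Continuous η := hη.continuous
  have hQc : ∀ g : E → E, Continuous g → Continuous fun x => Q (g x) (g x) := fun g hg =>
    (Q.continuous.comp hg).clm_apply hg
  have hpos : 0 < ∫ x in Metric.ball x₀ r, η x ^ 2 ∂μ := by
    rw [setIntegral_pos_iff_support_of_nonneg_ae (Filter.Eventually.of_forall fun x => sq_nonneg _)
      (Continuous.integrableOn_ball (by fun_prop))]
    refine (Metric.measure_ball_pos μ x₀ (show (0:ℝ) < r / 4 by linarith)).trans_le
      (measure_mono fun x hx => ⟨?_, Metric.ball_subset_ball (by linarith) hx⟩)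
    have : η x = 1 := η.one_of_mem_closedBall (Metric.ball_subset_closedBall hx)
    simp [this]
  have key : ∀ k : ℝ, 0 ≤ (∫ x in Metric.ball x₀ r, Q (gradient η x) (gradient η x) ∂μ)
      + k ^ 2 * Q z z * ∫ x in Metric.ball x₀ r, η x ^ 2 ∂μ := by
    intro k
    have hl : ∀ x, HasFDerivAt (fun x => k * inner ℝ z x) (k • innerSL ℝ z) x := fun x =>
      (innerSL ℝ z).hasFDerivAt.const_mul k
    have hlc : ContDiff ℝ (⊤ : ℕ∞) fun x : E => k * inner ℝ z x :=
      contDiff_const.mul (contDiff_const.inner ℝ contDiff_id)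
    have hc := hQ (fun x => η x * Real.cos (k * inner ℝ z x))
      (fun x => Real.cos (k * inner ℝ z x) • gradient η x
        + (-(k * η x * Real.sin (k * inner ℝ z x))) • z)
      (hη.mul (Real.contDiff_cos.comp hlc))
      ((tsupport_mul_subset_left).trans hηs) (fun x => by
        rw [hasGradientAt_iff_hasFDerivAt]
        refine ((hη' x).hasFDerivAt.mul (hl x).cos).congr_fderiv ?_
        ext v
        simp
        ring)
    have hs := hQ (fun x => η x * Real.sin (k * inner ℝ z x))
      (fun x => Real.sin (k * inner ℝ z x) • gradient η x
        + (k * η x * Real.cos (k * inner ℝ z x)) • z)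
      (hη.mul (Real.contDiff_sin.comp hlc))
      ((tsupport_mul_subset_left).trans hηs) (fun x => by
        rw [hasGradientAt_iff_hasFDerivAt]
        refine ((hη' x).hasFDerivAt.mul (hl x).sin).congr_fderiv ?_
        ext v
        simp
        ring)
    have hsum := add_nonneg hc hs
    rw [← integral_add (Continuous.integrableOn_ball (hQc _ (by fun_prop))) (Continuous.integrableOn_ball (hQc _ (by fun_prop)))] at hsum
    refine hsum.trans_eq ?_
    rw [← integral_const_mul, ← integral_add (Continuous.integrableOn_ball (hQc _ hgc)) (Continuous.integrableOn_ball (by fun_prop))]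
    refine integral_congr_ae (Filter.Eventually.of_forall fun x => ?_)
    simp only [map_add, map_smul, add_apply, smul_apply,
      smul_eq_mul]
    linear_combination (Q (gradient η x) (gradient η x) + k ^ 2 * Q z z * η x ^ 2) *
      Real.sin_sq_add_cos_sq (k * inner ℝ z x)
  by_contra! hneg
  set a := ∫ x in Metric.ball x₀ r, Q (gradient η x) (gradient η x) ∂μ
  set m := -(Q z z * ∫ x in Metric.ball x₀ r, η x ^ 2 ∂μ) with hm
  have hm0 : 0 < m := by rw [hm]; nlinarith
  have h1 := key 0
  have h3 := key (Real.sqrt ((a + 1) / m))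
  rw [Real.sq_sqrt (div_nonneg (by linarith) hm0.le)] at h3
  have h4 : (a + 1) / m * m = a + 1 := div_mul_cancel₀ _ hm0.ne'
  have h5 : (a + 1) / m * Q z z * (∫ x in Metric.ball x₀ r, η x ^ 2 ∂μ) = -((a + 1) / m * m) := by
    rw [hm]; ring
  linarith

end

/-- uniform `W^{1,H}`-quasiconvexity with respect to the double phase
function `H(t) = t^p + a₀ t^q` implies the strong Legendre–Hadamard condition for the
Hessian of `f`. -/
theorem stmt_2 (n N : ℕ) (hn : 2 ≤ n) (hN : 1 ≤ N)
    (p q ν : ℝ) (hp : 1 < p) (hpq : p ≤ q) (hν : 0 < ν) :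
    ∃ c : ℝ, 0 < c ∧
      ∀ (a₀ : ℝ), 0 ≤ a₀ →
      ∀ f : EuclideanSpace ℝ (Fin N × Fin n) → ℝ,
        ContDiff ℝ 1 f → ContDiffOn ℝ 2 f {0}ᶜ →
        (∀ (P : EuclideanSpace ℝ (Fin N × Fin n)) (x₀ : EuclideanSpace ℝ (Fin n)) (r : ℝ),
          0 < r →
          ∀ ζ : EuclideanSpace ℝ (Fin n) → EuclideanSpace ℝ (Fin N),
            ContDiff ℝ (⊤ : ℕ∞) ζ → tsupport ζ ⊆ Metric.ball x₀ r →
            ν * ∫ x in Metric.ball x₀ r,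
                (p * (p - 1) * (‖P‖ + ‖matDeriv ζ x‖) ^ (p - 2) +
                  a₀ * (q * (q - 1) * (‖P‖ + ‖matDeriv ζ x‖) ^ (q - 2))) *
                  ‖matDeriv ζ x‖ ^ 2
              ≤ ∫ x in Metric.ball x₀ r, (f (P + matDeriv ζ x) - f P)) →
        ∀ P : EuclideanSpace ℝ (Fin N × Fin n), P ≠ 0 →
        ∀ (b : EuclideanSpace ℝ (Fin N)) (z : EuclideanSpace ℝ (Fin n)),
          c * (p * (p - 1) * ‖P‖ ^ (p - 2) + a₀ * (q * (q - 1) * ‖P‖ ^ (q - 2))) *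
              ‖b‖ ^ 2 * ‖z‖ ^ 2
            ≤ fderiv ℝ (fderiv ℝ f) P (tensorMat b z) (tensorMat b z) := by
  refine ⟨2 * ν, by positivity, fun a₀ ha f hf hf2 hq P hP b z => ?_⟩
  have h2 : DifferentiableAt ℝ (fderiv ℝ f) P :=
    ((hf2.contDiffAt (isOpen_compl_singleton.mem_nhds hP)).fderiv_right (m := 1)
      (by norm_num)).differentiableAt one_ne_zero
  let κ : ℝ → ℝ := fun s => p * (p - 1) * s ^ (p - 2) + a₀ * (q * (q - 1) * s ^ (q - 2))
  have hrpow : ∀ e : ℝ, ContinuousOn (fun s : ℝ => s ^ e) (Set.Ioi 0) := fun e s hs =>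
    (Real.continuousAt_rpow_const s e (Or.inl (ne_of_gt hs))).continuousWithinAt
  have hκ : ContinuousOn κ (Set.Ioi 0) :=
    (continuousOn_const.mul (hrpow _)).add
      (continuousOn_const.mul (continuousOn_const.mul (hrpow _)))
  let T : EuclideanSpace ℝ (Fin n) →L[ℝ] EuclideanSpace ℝ (Fin N × Fin n) :=
    LinearMap.toContinuousLinearMap
      { toFun := tensorMat b
        map_add' := tensorMat_add b
        map_smul' := tensorMat_smul b }
  have hT : ∀ v, T v = tensorMat b v := fun v => rfl
  let Q : EuclideanSpace ℝ (Fin n) →L[ℝ] EuclideanSpace ℝ (Fin n) →L[ℝ] ℝ :=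
    (fderiv ℝ (fderiv ℝ f) P).bilinearComp T T
      - (2 * ν * κ ‖P‖ * ‖b‖ ^ 2) • (innerₗ (EuclideanSpace ℝ (Fin n))).toContinuousBilinearMap
  have hQ : ∀ v, Q v v = fderiv ℝ (fderiv ℝ f) P (tensorMat b v) (tensorMat b v)
      - 2 * ν * κ ‖P‖ * ‖tensorMat b v‖ ^ 2 := by
    intro v
    simp [Q, hT, norm_tensorMat_sq, mul_assoc]
  have hmain := bilin_nonneg_of_integral_gradient_nonneg volume Q (x₀ := 0) one_pos
    (fun u g hu hs hg => by
      have hζ : ContDiff ℝ (⊤ : ℕ∞) fun x => u x • b := hu.smul contDiff_const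
      have h := integral_hessian_ge hf hP h2 hκ hν (hq P 0 1 one_pos) hζ
        ((tsupport_smul_subset_left u fun _ => b).trans hs)
      have hD : Continuous fun x => tensorMat b (g x) := by
        have := continuous_matDeriv (hζ.of_le (by exact_mod_cast le_top))
        rwa [funext fun x => matDeriv_smul_const (hg x) b] at this
      simp only [fun x => matDeriv_smul_const (hg x) b] at h
      simp only [hQ]
      have hAc : Continuous fun x =>
          fderiv ℝ (fderiv ℝ f) P (tensorMat b (g x)) (tensorMat b (g x)) :=
        ((fderiv ℝ (fderiv ℝ f) P).continuous.comp hD).clm_apply hD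
      rw [integral_sub hAc.integrableOn_ball
        (Continuous.integrableOn_ball (by fun_prop)), integral_const_mul]
      linarith) z
  rw [hQ, norm_tensorMat_sq] at hmain
  simp only [κ] at hmain
  linarith
end

section
/- Let N, n ≥ 1, 1 < p ≤ q, a₀ ≥ 0, L > 0, and let H(t) = t^p + a₀·t^q. Let f : ℝ^{N×n} → ℝ be C¹ on ℝ^{N×n} and C² on ℝ^{N×n}∖{0}, with gradient ∂f and Hessian ∂²f, and suppose |∂²f(P)| ≤ L·H''(|P|) for every P ≠ 0. Then there exists a constant c > 0, depending only on p, q, L, such that for all P, Q ∈ ℝ^{N×n} with P ≠ Q: |∂f(P) − ∂f(Q)| ≤ c·(H'(|P| + |P−Q|)/(|P| + |P−Q|))·|P−Q|. -/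
/-- On `[s / 3, s]` the power `z ^ (r - 2)` is controlled by its value at `s`. -/
theorem rpow_sub_two_le_of_div_three_le {q r s z : ℝ} (hr : 1 < r) (hrq : r ≤ q) (hs : 0 < s)
    (hz : s / 3 ≤ z) (hzs : z ≤ s) : z ^ (r - 2) ≤ 3 ^ q * s ^ (r - 2) := by
  have hz0 : 0 < z := by linarith
  have hs' : 0 ≤ s ^ (r - 2) := by positivity
  rcases le_total 2 r with h | h
  · have h1 : z ^ (r - 2) ≤ s ^ (r - 2) := Real.rpow_le_rpow hz0.le hzs (by linarith)
    have h2 : (1 : ℝ) ≤ 3 ^ q := Real.one_le_rpow (by norm_num) (by linarith)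
    nlinarith
  · have h1 : z ^ (r - 2) ≤ (s / 3) ^ (r - 2) :=
      Real.rpow_le_rpow_of_nonpos (by positivity) hz (by linarith)
    have h2 : (s / 3) ^ (r - 2) = 3 ^ (2 - r) * s ^ (r - 2) := by
      rw [Real.div_rpow hs.le (by norm_num), ← neg_sub r 2, Real.rpow_neg (by norm_num)]
      field_simp
    have h3 : (3 : ℝ) ^ (2 - r) ≤ 3 ^ q :=
      Real.rpow_le_rpow_of_exponent_le (by norm_num) (by linarith)
    calc _ ≤ _ := h1
      _ = _ := h2
      _ ≤ _ := by gcongr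

section DoublePhase

open Set Filter Topology

variable {E F : Type*} [NormedAddCommGroup E] [NormedSpace ℝ E]
  [NormedAddCommGroup F] [NormedSpace ℝ F]

/-- A map whose derivative is bounded by `L * H''` off the origin grows at most like `L * H'`
along rays, where `H t = t ^ p + a * t ^ q`. -/
theorem norm_sub_zero_le_of_norm_fderiv_le {p q L a : ℝ} {g : E → F}
    (hp : 1 < p) (hq : 1 < q) (hg : Continuous g)
    (hd : ∀ x, x ≠ 0 → DifferentiableAt ℝ g x)
    (hb : ∀ x, x ≠ 0 → ‖fderiv ℝ g x‖ ≤
      L * (p * (p - 1) * ‖x‖ ^ (p - 2) + a * (q * (q - 1) * ‖x‖ ^ (q - 2)))) (x : E) :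
    ‖g x - g 0‖ ≤ L * (p * ‖x‖ ^ (p - 1) + a * q * ‖x‖ ^ (q - 1)) := by
  rcases eq_or_ne x 0 with rfl | hx
  · simp [Real.zero_rpow (sub_pos.2 hp).ne', Real.zero_rpow (sub_pos.2 hq).ne']
  have hx0 : 0 < ‖x‖ := norm_pos_iff.2 hx
  set B : ℝ → ℝ := fun t => L * (p * (t * ‖x‖) ^ (p - 1) + a * q * (t * ‖x‖) ^ (q - 1)) with hB
  have hBcont : Continuous B := by
    have h1 : Continuous fun t : ℝ => (t * ‖x‖) ^ (p - 1) :=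
      (continuous_id.mul continuous_const).rpow_const fun _ => .inr (by linarith)
    have h2 : Continuous fun t : ℝ => (t * ‖x‖) ^ (q - 1) :=
      (continuous_id.mul continuous_const).rpow_const fun _ => .inr (by linarith)
    fun_prop
  have hpow : ∀ (r t : ℝ), 0 < t →
      HasDerivAt (fun t : ℝ => (t * ‖x‖) ^ (r - 1)) ((r - 1) * (t * ‖x‖) ^ (r - 2) * ‖x‖) t := by
    intro r t ht
    have h := ((hasDerivAt_id t).mul_const ‖x‖).rpow_const (p := r - 1)
      (.inl (mul_pos ht hx0).ne')
    refine h.congr_deriv ?_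
    rw [show r - 1 - 1 = r - 2 by ring]
    simp only [id]
    ring
  have hB' : ∀ t : ℝ, 0 < t → HasDerivAt B
      (L * (p * (p - 1) * (t * ‖x‖) ^ (p - 2) +
        a * (q * (q - 1) * (t * ‖x‖) ^ (q - 2))) * ‖x‖) t := by
    intro t ht
    refine ((((hpow p t ht).const_mul p).add ((hpow q t ht).const_mul (a * q))).const_mul
      L).congr_deriv ?_
    ring
  have hgc : Continuous fun t : ℝ => g (t • x) := by fun_prop
  have key : ∀ ε ∈ Ioo (0 : ℝ) 1, ‖g x - g (ε • x)‖ ≤ B 1 - B ε := by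
    rintro ε ⟨hε, hε1⟩
    have := image_norm_le_of_norm_deriv_right_le_deriv_boundary'
      (f := fun t : ℝ => g (t • x) - g (ε • x)) (f' := fun t => fderiv ℝ g (t • x) x)
      (a := ε) (b := 1) (B := fun t => B t - B ε)
      (hgc.sub continuous_const).continuousOn
      (fun t ht => ?_) (by simp) (hBcont.sub continuous_const).continuousOn
      (fun t ht => ((hB' t (hε.trans_le ht.1)).sub_const _).hasDerivWithinAt)
      (fun t ht => ?_) (right_mem_Icc.2 hε1.le)
    · simpa using this
    · have ht0 : 0 < t := hε.trans_le ht.1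
      have h1 : HasDerivAt (fun t : ℝ => t • x) x t := by
        simpa using (hasDerivAt_id t).smul_const x
      exact (((hd (t • x) (smul_ne_zero ht0.ne' hx)).hasFDerivAt.comp_hasDerivAt t h1).sub_const
        _).hasDerivWithinAt
    · have ht0 : 0 < t := hε.trans_le ht.1
      have h2 := hb (t • x) (smul_ne_zero ht0.ne' hx)
      rw [norm_smul, Real.norm_of_nonneg ht0.le] at h2
      exact (ContinuousLinearMap.le_opNorm _ _).trans (by gcongr)
  have hlim1 : Tendsto (fun ε : ℝ => ‖g x - g (ε • x)‖) (𝓝[>] 0) (𝓝 ‖g x - g 0‖) := by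
    have : Continuous fun ε : ℝ => ‖g x - g (ε • x)‖ := by fun_prop
    simpa using (this.tendsto 0).mono_left nhdsWithin_le_nhds
  have hlim2 : Tendsto (fun ε : ℝ => B 1 - B ε) (𝓝[>] 0) (𝓝 (B 1 - B 0)) :=
    ((continuous_const.sub hBcont).tendsto 0).mono_left nhdsWithin_le_nhds
  have hle := le_of_tendsto_of_tendsto hlim1 hlim2
    (eventually_of_mem (Ioo_mem_nhdsGT one_pos) key)
  simpa [hB, Real.zero_rpow (sub_pos.2 hp).ne', Real.zero_rpow (sub_pos.2 hq).ne'] using hle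

/-- A map whose derivative is bounded by `L * H''` off the origin satisfies the increment estimate
given by the shifted function of `H t = t ^ p + a * t ^ q`. -/
theorem norm_sub_le_of_norm_fderiv_le {p q L a : ℝ} {g : E → F}
    (hp : 1 < p) (hpq : p ≤ q) (hL : 0 < L) (ha : 0 ≤ a) (hg : Continuous g)
    (hd : ∀ x, x ≠ 0 → DifferentiableAt ℝ g x)
    (hb : ∀ x, x ≠ 0 → ‖fderiv ℝ g x‖ ≤
      L * (p * (p - 1) * ‖x‖ ^ (p - 2) + a * (q * (q - 1) * ‖x‖ ^ (q - 2))))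
    {x y : E} (hxy : x ≠ y) :
    ‖g x - g y‖ ≤ L * (6 + q * 3 ^ q) *
      ((p * (‖x‖ + ‖x - y‖) ^ (p - 1) + a * q * (‖x‖ + ‖x - y‖) ^ (q - 1)) /
        (‖x‖ + ‖x - y‖)) * ‖x - y‖ := by
  have hd0 : 0 < ‖x - y‖ := norm_pos_iff.2 (sub_ne_zero.2 hxy)
  have hx0 := norm_nonneg x
  set s := ‖x‖ + ‖x - y‖ with hs
  have hs0 : 0 < s := by positivity
  have hq : 1 < q := hp.trans_le hpq
  have hp0 : 0 < p := by linarith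
  have hq0 : 0 < q := by linarith
  set D := p * s ^ (p - 1) + a * q * s ^ (q - 1) with hD
  have hD0 : 0 ≤ D := by positivity
  have h3 : (0 : ℝ) < 3 ^ q := by positivity
  rcases le_or_gt ‖x - y‖ (‖x‖ / 2) with h | h
  · have hball : ∀ z ∈ Metric.closedBall x ‖x - y‖, s / 3 ≤ ‖z‖ ∧ ‖z‖ ≤ s := by
      intro z hz
      rw [mem_closedBall_iff_norm] at hz
      have h1 := norm_sub_norm_le z x
      have h2 := norm_sub_norm_le x z
      rw [norm_sub_rev] at h2
      constructor <;> linarith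
    have hne : ∀ z ∈ Metric.closedBall x ‖x - y‖, z ≠ 0 := fun z hz =>
      norm_pos_iff.1 ((by positivity : 0 < s / 3).trans_le (hball z hz).1)
    have hbound : ∀ z ∈ Metric.closedBall x ‖x - y‖,
        ‖fderiv ℝ g z‖ ≤ L * (q * 3 ^ q) * (D / s) := by
      intro z hz
      obtain ⟨hz1, hz2⟩ := hball z hz
      have e1 := rpow_sub_two_le_of_div_three_le hp hpq hs0 hz1 hz2
      have e2 := rpow_sub_two_le_of_div_three_le hq le_rfl hs0 hz1 hz2
      have hDs : D / s = p * s ^ (p - 2) + a * q * s ^ (q - 2) := by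
        have h1 (r : ℝ) : s ^ (r - 2) = s ^ (r - 1) / s := by
          rw [← Real.rpow_sub_one hs0.ne']
          ring_nf
        rw [hD, h1, h1]
        ring
      calc ‖fderiv ℝ g z‖ ≤ _ := hb z (hne z hz)
        _ ≤ L * (p * q * (3 ^ q * s ^ (p - 2)) + a * (q * q * (3 ^ q * s ^ (q - 2)))) := by
          gcongr <;> linarith
        _ = L * (q * 3 ^ q) * (D / s) := by rw [hDs]; ring
    have hmv := (convex_closedBall x ‖x - y‖).norm_image_sub_le_of_norm_fderiv_le
      (𝕜 := ℝ) (fun z hz => hd z (hne z hz)) hbound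
      (x := y) (y := x) (by rw [mem_closedBall_iff_norm, norm_sub_rev]) (by simp)
    refine hmv.trans ?_
    gcongr
    linarith
  · have hy : ‖y‖ ≤ s := by
      have := norm_sub_norm_le y x
      rw [norm_sub_rev] at this
      linarith
    have hzero : ∀ z : E, ‖z‖ ≤ s → ‖g z - g 0‖ ≤ L * D := fun z hz =>
      (norm_sub_zero_le_of_norm_fderiv_le hp hq hg hd hb z).trans (by rw [hD]; gcongr)
    have h1 := hzero x (by linarith)
    have h2 := hzero y hy
    calc ‖g x - g y‖ ≤ ‖g x - g 0‖ + ‖g y - g 0‖ := by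
          simpa using norm_sub_le (g x - g 0) (g y - g 0)
      _ ≤ 2 * (L * D) := by linarith
      _ = L * 6 * (D / s) * (s / 3) := by field_simp; ring
      _ ≤ L * (6 + q * 3 ^ q) * (D / s) * ‖x - y‖ := by
        gcongr
        · linarith [mul_pos hq0 h3]
        · linarith

end DoublePhase

/-- if the Hessian of `f` grows like `H''` for the double phase function
`H(t) = t^p + a₀ t^q`, then differences of gradients are controlled by the derivative of
the shifted function: `|∂f(P) − ∂f(Q)| ≤ c · (H'(|P|+|P−Q|)/(|P|+|P−Q|)) · |P−Q|`. -/
theorem stmt_3 (p q L : ℝ) (hp : 1 < p) (hpq : p ≤ q) (hL : 0 < L) :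
    ∃ c : ℝ, 0 < c ∧
      ∀ (N n : ℕ), 1 ≤ N → 1 ≤ n →
      ∀ (a₀ : ℝ), 0 ≤ a₀ →
      ∀ f : EuclideanSpace ℝ (Fin N × Fin n) → ℝ,
        ContDiff ℝ 1 f → ContDiffOn ℝ 2 f {0}ᶜ →
        (∀ P : EuclideanSpace ℝ (Fin N × Fin n), P ≠ 0 →
          ‖fderiv ℝ (fderiv ℝ f) P‖ ≤
            L * (p * (p - 1) * ‖P‖ ^ (p - 2) + a₀ * (q * (q - 1) * ‖P‖ ^ (q - 2)))) →
        ∀ P Q : EuclideanSpace ℝ (Fin N × Fin n), P ≠ Q →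
          ‖gradient f P - gradient f Q‖ ≤
            c * ((p * (‖P‖ + ‖P - Q‖) ^ (p - 1) + a₀ * q * (‖P‖ + ‖P - Q‖) ^ (q - 1)) /
                (‖P‖ + ‖P - Q‖)) * ‖P - Q‖ := by
  refine ⟨L * (6 + q * 3 ^ q), by have := hp.trans_le hpq; positivity, ?_⟩
  intro N n _ _ a₀ ha f hf hf2 hb P Q hPQ
  have hnorm : ‖gradient f P - gradient f Q‖ = ‖fderiv ℝ f P - fderiv ℝ f Q‖ := by
    simp only [gradient, ← map_sub, LinearIsometryEquiv.norm_map]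
  rw [hnorm]
  refine norm_sub_le_of_norm_fderiv_le hp hpq hL ha (hf.continuous_fderiv one_ne_zero)
    (fun x hx => ?_) hb hPQ
  have h2 : ContDiffAt ℝ 2 f x := hf2.contDiffAt (isOpen_compl_singleton.mem_nhds hx)
  exact (h2.fderiv_right (m := 1) (by norm_num)).differentiableAt one_ne_zero
end

section
/- Let φ : [0,∞) → [0,∞) be differentiable with derivative φ', with φ(0) = 0, and let 1 < p₁ ≤ p₂ be such that p₁·φ(t) ≤ t·φ'(t) ≤ p₂·φ(t) for all t > 0. Define the conjugate φ*(t) = sup_{s ≥ 0} (s·t − φ(s)). Then there exists a constant c > 1, depending only on p₁ and p₂, such that for every t > 0: c^{−1}·φ(t) ≤ φ*(φ(t)/t) ≤ c·φ(t). -/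
/-- The lower index condition makes `s ↦ φ s * s ^ (-p)` nondecreasing on `(0, ∞)`. -/
theorem monotoneOn_mul_rpow_neg_of_index_le {p : ℝ} {φ φ' : ℝ → ℝ}
    (hd : ∀ t > (0 : ℝ), HasDerivAt φ (φ' t) t)
    (hi : ∀ t > (0 : ℝ), p * φ t ≤ t * φ' t) :
    MonotoneOn (fun s => φ s * s ^ (-p)) (Set.Ioi 0) := by
  have hderiv : ∀ s > (0 : ℝ), HasDerivAt (fun s => φ s * s ^ (-p))
      (φ' s * s ^ (-p) + φ s * (-p * s ^ (-p - 1))) s := fun s hs =>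
    (hd s hs).mul (Real.hasDerivAt_rpow_const (Or.inl hs.ne'))
  refine monotoneOn_of_deriv_nonneg (convex_Ioi 0)
    (fun s hs => (hderiv s hs).continuousAt.continuousWithinAt)
    (fun s hs => ?_) (fun s hs => ?_) <;> rw [interior_Ioi] at hs
  · exact (hderiv s hs).differentiableAt.differentiableWithinAt
  · have hs' : 0 < s := hs
    have hpow : s ^ (-p) = s * s ^ (-p - 1) := by
      rw [Real.rpow_sub_one hs'.ne']
      field_simp
    rw [(hderiv s hs).deriv, hpow]
    have h := mul_nonneg (sub_nonneg.2 (hi s hs)) (Real.rpow_nonneg hs'.le (-p - 1))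
    linarith

/-- The lower index condition gives `φ s * (t / s) ^ p ≤ φ t` for `s ≤ t`. -/
theorem mul_div_rpow_le_of_index_le {p : ℝ} {φ φ' : ℝ → ℝ}
    (hd : ∀ t > (0 : ℝ), HasDerivAt φ (φ' t) t)
    (hi : ∀ t > (0 : ℝ), p * φ t ≤ t * φ' t) {s t : ℝ} (hs : 0 < s) (hst : s ≤ t) :
    φ s * (t / s) ^ p ≤ φ t := by
  have ht : 0 < t := hs.trans_le hst
  have h := monotoneOn_mul_rpow_neg_of_index_le hd hi hs ht hst
  simp only [Real.rpow_neg hs.le, Real.rpow_neg ht.le, ← div_eq_mul_inv] at h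
  rw [le_div_iff₀ (Real.rpow_pos_of_pos ht p)] at h
  rw [Real.div_rpow ht.le hs.le]
  calc φ s * (t ^ p / s ^ p) = φ s / s ^ p * t ^ p := by ring
    _ ≤ φ t := h

/-- for an N-function `φ` with indices `p₁ ≤ p₂` and conjugate `φ*`,
one has `φ*(φ(t)/t) ∼ φ(t)` with constants depending only on `p₁, p₂`. -/
theorem stmt_8 (p₁ p₂ : ℝ) (hp₁ : 1 < p₁) (hp : p₁ ≤ p₂) :
    ∃ c : ℝ, 1 < c ∧
      ∀ (φ φ' : ℝ → ℝ),
        φ 0 = 0 →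
        (∀ t ∈ Set.Ici (0 : ℝ), 0 ≤ φ t) →
        (∀ t ∈ Set.Ici (0 : ℝ), HasDerivWithinAt φ (φ' t) (Set.Ici 0) t) →
        (∀ t > (0 : ℝ), p₁ * φ t ≤ t * φ' t ∧ t * φ' t ≤ p₂ * φ t) →
      ∀ (φstar : ℝ → ℝ),
        (∀ t, φstar t = sSup ((fun s => s * t - φ s) '' Set.Ici 0)) →
      ∀ t > (0 : ℝ),
        c⁻¹ * φ t ≤ φstar (φ t / t) ∧ φstar (φ t / t) ≤ c * φ t := by
  have h2 : (2 : ℝ) < 2 ^ p₁ := by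
    simpa using Real.rpow_lt_rpow_of_exponent_lt (one_lt_two : (1 : ℝ) < 2) hp₁
  have hinv : ((2 : ℝ) ^ p₁)⁻¹ < 1 / 2 := by
    rw [one_div]
    exact inv_strictAnti₀ two_pos h2
  have hinv0 : 0 < ((2 : ℝ) ^ p₁)⁻¹ := by positivity
  have hc : 1 < (1 / 2 - ((2 : ℝ) ^ p₁)⁻¹)⁻¹ :=
    (one_lt_inv₀ (by linarith)).2 (by linarith)
  refine ⟨_, hc, ?_⟩
  intro φ φ' _ hnn hd hi φstar hstar t ht
  have hd' : ∀ t > (0 : ℝ), HasDerivAt φ (φ' t) t := fun t ht =>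
    (hd t ht.le).hasDerivAt (Ici_mem_nhds ht)
  have hgrow {s t : ℝ} (hs : 0 < s) (hst : s ≤ t) : φ s * (t / s) ^ p₁ ≤ φ t :=
    mul_div_rpow_le_of_index_le hd' (fun t ht => (hi t ht).1) hs hst
  have hφt : 0 ≤ φ t := hnn t ht.le
  have hub : ∀ y ∈ (fun s => s * (φ t / t) - φ s) '' Set.Ici 0, y ≤ φ t := by
    rintro _ ⟨s, hs, rfl⟩
    have hφs : 0 ≤ φ s := hnn s hs
    have heq : s * (φ t / t) = φ t * (s / t) := by ring
    simp only [heq]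
    rcases le_total s t with hst | hst
    · have := mul_le_of_le_one_right hφt ((div_le_one ht).2 hst)
      linarith
    · have h1 : s / t ≤ (s / t) ^ p₁ :=
        Real.self_le_rpow_of_one_le ((one_le_div ht).2 hst) hp₁.le
      have := mul_le_mul_of_nonneg_left h1 hφt
      linarith [hgrow ht hst]
  rw [hstar, inv_inv]
  constructor
  · refine le_trans ?_ (le_csSup ⟨φ t, hub⟩ ⟨t / 2, (half_pos ht).le, rfl⟩)
    have h := hgrow (half_pos ht) (half_le_self ht.le)
    rw [div_div_cancel₀ ht.ne', ← le_div_iff₀ (by positivity), div_eq_mul_inv (φ t)] at h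
    have heq : t / 2 * (φ t / t) = φ t / 2 := by field_simp
    simp only [heq]
    linarith
  · exact (csSup_le (Set.nonempty_Ici.image _) hub).trans (le_mul_of_one_le_left hφt hc.le)
end

section
/- Let φ : [0,∞) → [0,∞) with φ(0) = 0 be continuously differentiable on [0,∞) with derivative φ' satisfying φ'(0) = 0, and twice differentiable on (0,∞) with second derivative φ''. Let 1 < p₁ ≤ p₂ and assume (p₁ − 1)·φ'(t) ≤ t·φ''(t) ≤ (p₂ − 1)·φ'(t) for all t > 0. Then p₁·φ(t) ≤ t·φ'(t) ≤ p₂·φ(t) for all t > 0. -/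
/-- The function `t φ'(t) - p φ(t)` is continuous on `[0,∞)`, and on `(0,∞)` its derivative is
`t φ''(t) - (p - 1) φ'(t)`. -/
theorem continuousOn_and_hasDerivAt_mul_deriv_sub {φ φ' φ'' : ℝ → ℝ} (p : ℝ)
    (hder : ∀ t ∈ Set.Ici (0 : ℝ), HasDerivWithinAt φ (φ' t) (Set.Ici 0) t)
    (hdercont : ContinuousOn φ' (Set.Ici 0))
    (hder2 : ∀ t ∈ Set.Ioi (0 : ℝ), HasDerivAt φ' (φ'' t) t) :
    ContinuousOn (fun t ↦ t * φ' t - p * φ t) (Set.Ici 0) ∧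
      ∀ t ∈ Set.Ioi (0 : ℝ),
        HasDerivAt (fun t ↦ t * φ' t - p * φ t) (t * φ'' t - (p - 1) * φ' t) t := by
  have hφ : ContinuousOn φ (Set.Ici 0) := fun t ht ↦ (hder t ht).continuousWithinAt
  refine ⟨(continuousOn_id.mul hdercont).sub (continuousOn_const.mul hφ), fun t ht ↦ ?_⟩
  have hφt : HasDerivAt φ (φ' t) t := (hder t (Set.Ioi_subset_Ici_self ht)).hasDerivAt (Ici_mem_nhds ht)
  exact (((hasDerivAt_id' t).mul (hder2 t ht)).sub (hφt.const_mul p)).congr_deriv (by ring)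


/-- if `(p₁−1) φ'(t) ≤ t φ''(t) ≤ (p₂−1) φ'(t)` for all `t > 0`, where
`φ(0) = 0`, `φ'` is continuous with `φ'(0) = 0`, then `p₁ φ(t) ≤ t φ'(t) ≤ p₂ φ(t)`
for all `t > 0`. -/
theorem stmt_9 (φ φ' φ'' : ℝ → ℝ) (p₁ p₂ : ℝ) (hp₁ : 1 < p₁) (hp : p₁ ≤ p₂)
    (hφ0 : φ 0 = 0)
    (hφpos : ∀ t ∈ Set.Ici (0 : ℝ), 0 ≤ φ t)
    (hder : ∀ t ∈ Set.Ici (0 : ℝ), HasDerivWithinAt φ (φ' t) (Set.Ici 0) t)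
    (hdercont : ContinuousOn φ' (Set.Ici 0))
    (hφ'0 : φ' 0 = 0)
    (hder2 : ∀ t ∈ Set.Ioi (0 : ℝ), HasDerivAt φ' (φ'' t) t)
    (hidx2 : ∀ t > (0 : ℝ), (p₁ - 1) * φ' t ≤ t * φ'' t ∧ t * φ'' t ≤ (p₂ - 1) * φ' t) :
    ∀ t > (0 : ℝ), p₁ * φ t ≤ t * φ' t ∧ t * φ' t ≤ p₂ * φ t := by
  intro t ht
  obtain ⟨hc₁, hd₁⟩ := continuousOn_and_hasDerivAt_mul_deriv_sub p₁ hder hdercont hder2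
  obtain ⟨hc₂, hd₂⟩ := continuousOn_and_hasDerivAt_mul_deriv_sub p₂ hder hdercont hder2
  have hmono : MonotoneOn (fun t ↦ t * φ' t - p₁ * φ t) (Set.Ici 0) := by
    refine monotoneOn_of_hasDerivWithinAt_nonneg (convex_Ici 0) hc₁
      (f' := fun t ↦ t * φ'' t - (p₁ - 1) * φ' t) ?_ ?_ <;> rw [interior_Ici]
    · exact fun x hx ↦ (hd₁ x hx).hasDerivWithinAt
    · exact fun x hx ↦ sub_nonneg.2 (hidx2 x hx).1
  have hanti : AntitoneOn (fun t ↦ t * φ' t - p₂ * φ t) (Set.Ici 0) := by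
    refine antitoneOn_of_hasDerivWithinAt_nonpos (convex_Ici 0) hc₂
      (f' := fun t ↦ t * φ'' t - (p₂ - 1) * φ' t) ?_ ?_ <;> rw [interior_Ici]
    · exact fun x hx ↦ (hd₂ x hx).hasDerivWithinAt
    · exact fun x hx ↦ sub_nonpos.2 (hidx2 x hx).2
  have h₁ := hmono Set.self_mem_Ici ht.le ht.le
  have h₂ := hanti Set.self_mem_Ici ht.le ht.le
  simp only [hφ0, mul_zero, zero_mul, sub_zero] at h₁ h₂
  exact ⟨sub_nonneg.1 h₁, sub_nonpos.1 h₂⟩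
end

section
/- Let Ψ : [0,∞) → [0,∞) be nondecreasing and such that the map t ↦ Ψ(t)/t is nonincreasing on (0,∞). Then there exists a concave function Ψ̄ : [0,∞) → [0,∞) such that (1/2)·Ψ̄(t) ≤ Ψ(t) ≤ Ψ̄(t) for all t ≥ 0. -/
/-- The infimum of the affine functions `t ↦ Ψ s + t * (Ψ s / s)` over `s > 0`. -/
noncomputable def affineInf (Ψ : ℝ → ℝ) (t : ℝ) : ℝ :=
  ⨅ s : Set.Ioi (0 : ℝ), (Ψ s + t * (Ψ s / s))

lemma le_affine_of_monotoneOn_of_antitoneOn {Ψ : ℝ → ℝ}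
    (hΨpos : ∀ t ∈ Set.Ici (0 : ℝ), 0 ≤ Ψ t)
    (hmono : MonotoneOn Ψ (Set.Ici 0))
    (hanti : AntitoneOn (fun t => Ψ t / t) (Set.Ioi 0))
    {s t : ℝ} (hs : 0 < s) (ht : 0 ≤ t) : Ψ t ≤ Ψ s + t * (Ψ s / s) := by
  have hΨs : 0 ≤ Ψ s := hΨpos s hs.le
  rcases le_total t s with hts | hst
  · have h := hmono ht hs.le hts
    have : 0 ≤ t * (Ψ s / s) := by positivity
    linarith
  · have htpos : 0 < t := hs.trans_le hst
    have h : Ψ t / t ≤ Ψ s / s := hanti hs htpos hst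
    rw [div_le_iff₀ htpos] at h
    linarith

lemma affineInf_le {Ψ : ℝ → ℝ} (hΨpos : ∀ t ∈ Set.Ici (0 : ℝ), 0 ≤ Ψ t)
    {s t : ℝ} (hs : 0 < s) (ht : 0 ≤ t) : affineInf Ψ t ≤ Ψ s + t * (Ψ s / s) := by
  refine ciInf_le (f := fun s : Set.Ioi (0 : ℝ) => Ψ s + t * (Ψ s / s)) ⟨0, ?_⟩ ⟨s, hs⟩
  rintro _ ⟨⟨r, hr⟩, rfl⟩
  have hr' : 0 < r := hr
  have hΨr : 0 ≤ Ψ r := hΨpos r hr'.le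
  change 0 ≤ Ψ r + t * (Ψ r / r)
  positivity

lemma le_affineInf {Ψ : ℝ → ℝ} {c t : ℝ}
    (h : ∀ s, 0 < s → c ≤ Ψ s + t * (Ψ s / s)) : c ≤ affineInf Ψ t := by
  have : Nonempty (Set.Ioi (0 : ℝ)) := ⟨⟨1, Set.mem_Ioi.2 one_pos⟩⟩
  exact le_ciInf fun s => h s s.2

lemma concaveOn_affineInf {Ψ : ℝ → ℝ} (hΨpos : ∀ t ∈ Set.Ici (0 : ℝ), 0 ≤ Ψ t) :
    ConcaveOn ℝ (Set.Ici 0) (affineInf Ψ) := by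
  refine ⟨convex_Ici 0, fun x hx y hy a b ha hb hab => le_affineInf fun s hs => ?_⟩
  have h₁ := mul_le_mul_of_nonneg_left (affineInf_le hΨpos hs hx) ha
  have h₂ := mul_le_mul_of_nonneg_left (affineInf_le hΨpos hs hy) hb
  simp only [smul_eq_mul]
  calc a * affineInf Ψ x + b * affineInf Ψ y
      ≤ (a + b) * Ψ s + (a * x + b * y) * (Ψ s / s) := by linarith
    _ = Ψ s + (a * x + b * y) * (Ψ s / s) := by rw [hab, one_mul]

/-- Lowering the value of a concave function at the endpoint `0` preserves concavity. -/
lemma ConcaveOn.update_zero {f : ℝ → ℝ} {c : ℝ} (hf : ConcaveOn ℝ (Set.Ici 0) f)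
    (hc : c ≤ f 0) : ConcaveOn ℝ (Set.Ici 0) (Function.update f 0 c) := by
  have hle : Function.update f 0 c ≤ f := update_le_self_iff.2 hc
  refine ⟨hf.1, fun x hx y hy a b ha hb hab => ?_⟩
  simp only [smul_eq_mul]
  by_cases hz : a * x + b * y = 0
  · have hax : 0 ≤ a * x := mul_nonneg ha hx
    have hby : 0 ≤ b * y := mul_nonneg hb hy
    have key : ∀ r z : ℝ, r * z = 0 → r * Function.update f 0 c z = r * c := by
      intro r z h
      rcases mul_eq_zero.1 h with rfl | rfl <;> simp
    rw [hz, key a x (by linarith), key b y (by linarith), ← add_mul, hab]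
    simp
  · rw [Function.update_of_ne hz]
    have h := hf.2 hx hy ha hb hab
    simp only [smul_eq_mul] at h
    have h₁ := mul_le_mul_of_nonneg_left (hle x) ha
    have h₂ := mul_le_mul_of_nonneg_left (hle y) hb
    linarith

/-- a nondecreasing function `Ψ : [0,∞) → [0,∞)` with `t ↦ Ψ(t)/t`
nonincreasing is equivalent, up to a factor 2, to a concave function `Ψ̄`. -/
theorem stmt_11 (Ψ : ℝ → ℝ)
    (hΨpos : ∀ t ∈ Set.Ici (0 : ℝ), 0 ≤ Ψ t)
    (hmono : MonotoneOn Ψ (Set.Ici 0))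
    (hanti : AntitoneOn (fun t => Ψ t / t) (Set.Ioi 0)) :
    ∃ Ψbar : ℝ → ℝ,
      ConcaveOn ℝ (Set.Ici 0) Ψbar ∧
      (∀ t ∈ Set.Ici (0 : ℝ), 0 ≤ Ψbar t) ∧
      ∀ t ∈ Set.Ici (0 : ℝ), (1 / 2 : ℝ) * Ψbar t ≤ Ψ t ∧ Ψ t ≤ Ψbar t := by
  have hle : ∀ t ∈ Set.Ici (0 : ℝ), Ψ t ≤ affineInf Ψ t := fun t ht =>
    le_affineInf fun s hs => le_affine_of_monotoneOn_of_antitoneOn hΨpos hmono hanti hs ht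
  have hmain : ∀ t ∈ Set.Ici (0 : ℝ),
      (1 / 2 : ℝ) * Function.update (affineInf Ψ) 0 (Ψ 0) t ≤ Ψ t ∧
        Ψ t ≤ Function.update (affineInf Ψ) 0 (Ψ 0) t := by
    intro t ht
    rcases eq_or_ne t 0 with rfl | hne
    · have h := hΨpos 0 ht
      rw [Function.update_self]
      constructor <;> linarith
    · rw [Function.update_of_ne hne]
      have h := affineInf_le hΨpos (lt_of_le_of_ne ht hne.symm) ht
      rw [mul_div_cancel₀ _ hne] at h
      exact ⟨by linarith, hle t ht⟩
  exact ⟨Function.update (affineInf Ψ) 0 (Ψ 0),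
    (concaveOn_affineInf hΨpos).update_zero (hle 0 Set.self_mem_Ici),
    fun t ht => (hΨpos t ht).trans (hmain t ht).2, hmain⟩
end

section
/- Let φ : [0,∞) → [0,∞) be differentiable with nondecreasing derivative φ', with φ(0) = 0, and let 1 < p₁ ≤ p₂ be such that p₁·φ(t) ≤ t·φ'(t) ≤ p₂·φ(t) for all t > 0. For s ≥ 0 define the shifted function φ_s(t) = ∫₀^t φ'(s+τ)·τ/(s+τ) dτ. Then there exists a constant c ≥ 1, depending only on p₁ and p₂, such that for all s, t ≥ 0: c^{−1}·(φ_s(t) + φ(s)) ≤ φ(s + t) ≤ c·(φ_s(t) + φ(s)). -/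
open Set in
/-- If `t φ'(t) ≤ p φ(t)` for `t > 0`, then `φ` satisfies the doubling bound
`φ(2s) ≤ 2 ^ p φ(s)`. -/
theorem doubling_of_mul_deriv_le {p : ℝ} {φ φ' : ℝ → ℝ}
    (hd : ∀ t > (0 : ℝ), HasDerivAt φ (φ' t) t)
    (hle : ∀ t > (0 : ℝ), t * φ' t ≤ p * φ t) {s : ℝ} (hs : 0 < s) :
    φ (2 * s) ≤ 2 ^ p * φ s := by
  have hD : ∀ x > (0 : ℝ), HasDerivAt (fun x => φ x * x ^ (-p))
      (φ' x * x ^ (-p) + φ x * (-p * x ^ (-p - 1))) x := fun x hx =>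
    (hd x hx).mul (Real.hasDerivAt_rpow_const (Or.inl hx.ne'))
  have hanti : AntitoneOn (fun x => φ x * x ^ (-p)) (Ioi 0) := by
    refine antitoneOn_of_deriv_nonpos (convex_Ioi 0)
      (fun x hx => (hD x hx).continuousAt.continuousWithinAt)
      (fun x hx => (hD x (interior_subset hx)).differentiableAt.differentiableWithinAt)
      fun x hx => ?_
    have hx0 : 0 < x := interior_subset hx
    have hpow : x ^ (-p) = x * x ^ (-p - 1) := by
      rw [Real.rpow_sub_one hx0.ne']
      field_simp
    rw [(hD x hx0).deriv, hpow]
    nlinarith [mul_nonneg (sub_nonneg.2 (hle x hx0)) (Real.rpow_nonneg hx0.le (-p - 1))]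
  have h : φ (2 * s) * (2 * s) ^ (-p) ≤ φ s * s ^ (-p) :=
    hanti (mem_Ioi.2 hs) (mem_Ioi.2 (by positivity)) (by linarith)
  rw [Real.mul_rpow two_pos.le hs.le, ← mul_assoc] at h
  have h2 := le_of_mul_le_mul_right h (Real.rpow_pos_of_pos hs _)
  rwa [Real.rpow_neg two_pos.le, ← div_eq_mul_inv, div_le_iff₀ (by positivity),
    mul_comm (φ s)] at h2

open Set in
/-- The integrand `φ'(s + τ) τ / (s + τ)` of the shifted function is nondecreasing. -/
theorem monotoneOn_shifted_integrand {φ' : ℝ → ℝ} (hmono : MonotoneOn φ' (Ici 0))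
    (hpos : ∀ t > (0 : ℝ), 0 ≤ φ' t) {s : ℝ} (hs : 0 ≤ s) :
    MonotoneOn (fun τ => φ' (s + τ) * τ / (s + τ)) (Ici 0) := by
  intro a ha b hb hab
  rw [mem_Ici] at ha hb
  rcases ha.eq_or_lt with rfl | ha0
  · rcases hb.eq_or_lt with rfl | hb0
    · exact le_rfl
    · have := hpos (s + b) (by positivity)
      simp only [mul_zero, zero_div]
      positivity
  · have hb0 := ha0.trans_le hab
    simp only [mul_div_assoc]
    refine mul_le_mul (hmono (mem_Ici.2 (by positivity)) (mem_Ici.2 (by positivity)) (by linarith))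
      ?_ (by positivity) (hpos _ (by positivity))
    rw [div_le_div_iff₀ (by positivity) (by positivity)]
    nlinarith


/-- for an N-function `φ` with indices `p₁ ≤ p₂` and nondecreasing
derivative, the shifted function `φ_s(t) = ∫₀ᵗ φ'(s+τ)·τ/(s+τ) dτ` satisfies
`φ(s+t) ∼ φ_s(t) + φ(s)` with constants depending only on `p₁, p₂`. -/
theorem stmt_12 (p₁ p₂ : ℝ) (hp₁ : 1 < p₁) (hp : p₁ ≤ p₂) :
    ∃ c : ℝ, 1 ≤ c ∧
      ∀ (φ φ' : ℝ → ℝ),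
        φ 0 = 0 →
        (∀ t ∈ Set.Ici (0 : ℝ), 0 ≤ φ t) →
        (∀ t ∈ Set.Ici (0 : ℝ), HasDerivWithinAt φ (φ' t) (Set.Ici 0) t) →
        MonotoneOn φ' (Set.Ici 0) →
        (∀ t > (0 : ℝ), p₁ * φ t ≤ t * φ' t ∧ t * φ' t ≤ p₂ * φ t) →
      ∀ s ≥ (0 : ℝ), ∀ t ≥ (0 : ℝ),
        c⁻¹ * ((∫ τ in (0 : ℝ)..t, φ' (s + τ) * τ / (s + τ)) + φ s) ≤ φ (s + t) ∧
        φ (s + t) ≤ c * ((∫ τ in (0 : ℝ)..t, φ' (s + τ) * τ / (s + τ)) + φ s) := by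
  have hc : (2 : ℝ) ≤ 2 ^ p₂ := by
    simpa using Real.rpow_le_rpow_of_exponent_le one_le_two (hp₁.le.trans hp)
  refine ⟨2 ^ p₂, by linarith, fun φ φ' h0 hnn hder hmono hidx s hs t ht => ?_⟩
  have hd : ∀ x > (0 : ℝ), HasDerivAt φ (φ' x) x := fun x hx =>
    (hder x hx.le).hasDerivAt (Ici_mem_nhds hx)
  have hpos : ∀ x > (0 : ℝ), 0 ≤ φ' x := fun x hx =>
    nonneg_of_mul_nonneg_right
      ((mul_nonneg (by linarith) (hnn x hx.le)).trans (hidx x hx).1) hx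
  have hFmono := monotoneOn_shifted_integrand hmono hpos hs
  set F : ℝ → ℝ := fun τ => φ' (s + τ) * τ / (s + τ) with hF
  have hsub : ∀ {a b : ℝ}, 0 ≤ a → a ≤ b → Set.uIcc a b ⊆ Set.Ici 0 := fun ha hab x hx =>
    ha.trans (Set.uIcc_of_le hab ▸ hx).1
  have hFint : ∀ {a b : ℝ}, 0 ≤ a → a ≤ b → IntervalIntegrable F MeasureTheory.volume a b :=
    fun ha hab => (hFmono.mono (hsub ha hab)).intervalIntegrable
  have hgmono : MonotoneOn (fun τ => φ' (s + τ)) (Set.Ici 0) := fun a ha b hb hab =>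
    hmono (Set.mem_Ici.2 (add_nonneg hs ha)) (Set.mem_Ici.2 (add_nonneg hs hb)) (by linarith)
  have hgint : ∀ {a b : ℝ}, 0 ≤ a → a ≤ b →
      IntervalIntegrable (fun τ => φ' (s + τ)) MeasureTheory.volume a b :=
    fun ha hab => (hgmono.mono (hsub ha hab)).intervalIntegrable
  have hFTC : ∀ {a b : ℝ}, 0 ≤ a → a ≤ b →
      ∫ τ in a..b, φ' (s + τ) = φ (s + b) - φ (s + a) := fun {a b} ha hab => by
    refine intervalIntegral.integral_eq_sub_of_hasDerivAt_of_le (f := fun τ => φ (s + τ))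
      hab ?_ (fun x hx => ?_) (hgint ha hab)
    · have hcont : ContinuousOn φ (Set.Ici 0) := fun x hx => (hder x hx).continuousWithinAt
      exact hcont.comp (by fun_prop) fun x hx => add_nonneg hs (ha.trans hx.1)
    · exact (hd (s + x) (by linarith [hx.1])).comp_const_add s x
  have hFnn : ∀ {x : ℝ}, 0 ≤ x → 0 ≤ F x := fun hx => by
    simpa [hF] using hFmono Set.self_mem_Ici hx hx
  have hI : ∀ {a b : ℝ}, 0 ≤ a → a ≤ b → 0 ≤ ∫ τ in a..b, F τ := fun ha hab =>
    intervalIntegral.integral_nonneg hab fun x hx => hFnn (ha.trans hx.1)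
  constructor
  · have hle : ∫ τ in (0 : ℝ)..t, F τ ≤ ∫ τ in (0 : ℝ)..t, φ' (s + τ) := by
      refine intervalIntegral.integral_mono_on_of_le_Ioo ht (hFint le_rfl ht) (hgint le_rfl ht)
        fun x hx => ?_
      have hsx : 0 < s + x := by linarith [hx.1]
      rw [hF, div_le_iff₀ hsx]
      exact mul_le_mul_of_nonneg_left (by linarith) (hpos _ hsx)
    rw [hFTC le_rfl ht, add_zero] at hle
    refine (mul_le_of_le_one_left (add_nonneg (hI le_rfl ht) (hnn s hs))
      (inv_le_one_of_one_le₀ (by linarith))).trans (by linarith)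
  · have hdbl : φ (s + s) ≤ 2 ^ p₂ * φ s := by
      rcases hs.eq_or_lt with rfl | hs0
      · simp [h0]
      · rw [← two_mul]
        exact doubling_of_mul_deriv_le hd (fun x hx => (hidx x hx).2) hs0
    rw [mul_add]
    rcases le_total t s with hts | hst
    · have hmid : ∫ _ in t..s, (0 : ℝ) ≤ ∫ τ in t..s, φ' (s + τ) :=
        intervalIntegral.integral_mono_on_of_le_Ioo hts (by simp) (hgint ht hts)
          fun x hx => hpos _ (by linarith [hx.1])
      rw [hFTC ht hts, intervalIntegral.integral_zero] at hmid
      have := mul_nonneg (by linarith : (0 : ℝ) ≤ 2 ^ p₂) (hI le_rfl ht)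
      linarith
    · have hle : ∫ τ in s..t, φ' (s + τ) ≤ ∫ τ in s..t, 2 * F τ := by
        refine intervalIntegral.integral_mono_on_of_le_Ioo hst (hgint hs hst)
          ((hFint hs hst).const_mul 2) fun x hx => ?_
        have hsx : 0 < s + x := by linarith [hx.1]
        rw [hF, ← mul_div_assoc, le_div_iff₀ hsx]
        nlinarith [hpos _ hsx, hx.1]
      rw [hFTC hs hst, intervalIntegral.integral_const_mul] at hle
      have hadd := intervalIntegral.integral_add_adjacent_intervals
        (hFint le_rfl hs) (hFint hs hst)
      have := mul_le_mul_of_nonneg_right hc (hI le_rfl ht)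
      linarith [hI le_rfl hs]
end

section
/- Let φ : [0,∞) → [0,∞) be differentiable with nondecreasing derivative φ', with φ(0) = 0, and let 1 < p₁ ≤ p₂ be such that p₁·φ(t) ≤ t·φ'(t) ≤ p₂·φ(t) for all t > 0. For s ≥ 0 define the shifted function φ_s(t) = ∫₀^t φ'(s+τ)·τ/(s+τ) dτ and its conjugate φ_s*(t) = sup_{τ ≥ 0} (t·τ − φ_s(τ)). Then there exists a constant c ≥ 1, depending only on p₁ and p₂, such that for all κ ∈ [0,1] and all s ≥ 0: c^{−1}·κ²·φ(s) ≤ φ_s*(κ·φ'(s)) ≤ c·κ²·φ(s). -/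
open Set MeasureTheory

/-- A function `φ` with `p φ(t) ≤ t φ'(t)` grows at least like `t ^ p`. -/
lemma rpow_mul_le_of_index_le {φ φ' : ℝ → ℝ} {p s l : ℝ}
    (hd : ∀ t > 0, HasDerivAt φ (φ' t) t) (hp : ∀ t > 0, p * φ t ≤ t * φ' t)
    (hs : 0 < s) (hl : 1 ≤ l) : l ^ p * φ s ≤ φ (l * s) := by
  have hderiv : ∀ t > 0, HasDerivAt (fun t => φ t * t ^ (-p))
      (φ' t * t ^ (-p) + φ t * (-p * t ^ (-p - 1))) t := fun t ht =>
    (hd t ht).mul (Real.hasDerivAt_rpow_const (Or.inl ht.ne'))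
  have hmono : MonotoneOn (fun t => φ t * t ^ (-p)) (Ici s) := by
    refine monotoneOn_of_deriv_nonneg (convex_Ici s)
      (fun t ht => (hderiv t (hs.trans_le ht)).continuousAt.continuousWithinAt)
      (fun t ht => ?_) (fun t ht => ?_)
    · rw [interior_Ici] at ht
      exact (hderiv t (hs.trans ht)).differentiableAt.differentiableWithinAt
    · rw [interior_Ici] at ht
      have ht0 : 0 < t := hs.trans ht
      rw [(hderiv t ht0).deriv]
      have h1 : t ^ (-p) = t ^ (-p - 1) * t := by
        rw [← Real.rpow_add_one ht0.ne']; ring_nf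
      have h2 : 0 ≤ t ^ (-p - 1) * (t * φ' t - p * φ t) :=
        mul_nonneg (Real.rpow_nonneg ht0.le _) (by linarith [hp t ht0])
      rw [h1]; linarith
  have hle : s ≤ l * s := le_mul_of_one_le_left hs.le hl
  have hl0 : 0 < l := by linarith
  have h := hmono self_mem_Ici hle hle
  simp only at h
  rw [Real.mul_rpow hl0.le hs.le, Real.rpow_neg hl0.le, Real.rpow_neg hs.le] at h
  have hlp := Real.rpow_pos_of_pos hl0 p
  have hsp := Real.rpow_pos_of_pos hs p
  have h' := mul_le_mul_of_nonneg_left h (mul_pos hlp hsp).le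
  field_simp at h'
  linarith

/-- The lower index `p > 1` forces `φ'` to grow by a definite factor under a large dilation. -/
lemma four_mul_deriv_le {φ φ' : ℝ → ℝ} {p q s l : ℝ} (hp1 : 1 < p)
    (hpos : ∀ t > 0, 0 ≤ φ t) (hd : ∀ t > 0, HasDerivAt φ (φ' t) t)
    (hp : ∀ t > 0, p * φ t ≤ t * φ' t) (hqs : s * φ' s ≤ q * φ s)
    (hs : 0 < s) (hl : 1 ≤ l) (hlq : 4 * q ≤ l ^ (p - 1)) : 4 * φ' s ≤ φ' (l * s) := by
  have hl0 : 0 < l := by linarith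
  have h1 := rpow_mul_le_of_index_le hd hp hs hl
  have h2 := hp (l * s) (mul_pos hl0 hs)
  have h3 : l ^ p = l ^ (p - 1) * l := by
    rw [← Real.rpow_add_one hl0.ne']; ring_nf
  have h4 : 4 * q * (l * φ s) ≤ l ^ (p - 1) * (l * φ s) :=
    mul_le_mul_of_nonneg_right hlq (mul_nonneg hl0.le (hpos s hs))
  have h5 : φ (l * s) ≤ p * φ (l * s) :=
    le_mul_of_one_le_left (hpos _ (mul_pos hl0 hs)) hp1.le
  have h6 := mul_le_mul_of_nonneg_left hqs hl0.le
  rw [h3] at h1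
  refine le_of_mul_le_mul_left ?_ (mul_pos hl0 hs)
  nlinarith

/-- The upper index `q` bounds the growth of `φ'` under the dilation by `1 + 1 / (2q)`. -/
lemma deriv_dilation_le {φ φ' : ℝ → ℝ} {q s : ℝ} (hq1 : 1 < q)
    (hd : ∀ t > 0, HasDerivAt φ (φ' t) t) (hmono : MonotoneOn φ' (Ici 0))
    (hnn : ∀ t > 0, 0 ≤ φ' t) (hs1 : φ s ≤ s * φ' s)
    (hq : ∀ t > 0, t * φ' t ≤ q * φ t) (hs : 0 < s) :
    φ' (s + s / (2 * q)) ≤ 2 * q * φ' s := by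
  have hd0 : 0 < s / (2 * q) := by positivity
  obtain ⟨x, hx, hslope⟩ := exists_hasDerivAt_eq_slope φ φ' (lt_add_of_pos_right s hd0)
    (fun t ht => (hd t (hs.trans_le ht.1)).continuousAt.continuousWithinAt)
    (fun t ht => hd t (hs.trans ht.1))
  set r := s + s / (2 * q) with hr
  have hrs : r - s = s / (2 * q) := by rw [hr]; ring
  have hr0 : 0 < r := by positivity
  have hxr : φ' x ≤ φ' r := hmono (hs.trans hx.1).le hr0.le hx.2.le
  have h1 : φ r - φ s ≤ s / (2 * q) * φ' r := by
    rw [hrs, eq_div_iff hd0.ne'] at hslope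
    nlinarith
  have h2 := hq r hr0
  have h3 : q * (s / (2 * q) * φ' r) = s * φ' r / 2 := by field_simp
  have h4 : s * φ' r ≤ r * φ' r :=
    mul_le_mul_of_nonneg_right (by linarith) (hnn r hr0)
  refine le_of_mul_le_mul_left ?_ hs
  nlinarith

/-- The integrand of the shifted function is nondecreasing. -/
lemma monotoneOn_shift_integrand {ψ : ℝ → ℝ} {s : ℝ} (hmono : MonotoneOn ψ (Ici 0))
    (hnn : ∀ t > 0, 0 ≤ ψ t) (hs : 0 ≤ s) :
    MonotoneOn (fun u => ψ (s + u) * u / (s + u)) (Ici 0) := by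
  intro u hu v hv huv
  rw [mem_Ici] at hu hv
  rcases hu.eq_or_lt with rfl | hu0
  · rcases hv.eq_or_lt with rfl | hv0
    · exact le_rfl
    · have := hnn (s + v) (by positivity)
      simp only [mul_zero, zero_div]
      positivity
  · have hv0 : 0 < v := hu0.trans_le huv
    simp only [mul_div_assoc]
    refine mul_le_mul (hmono (mem_Ici.2 (by positivity)) (mem_Ici.2 (by positivity)) (by linarith))
      ?_ (by positivity) (hnn _ (by positivity))
    rw [div_le_div_iff₀ (by positivity) (by positivity)]
    nlinarith

lemma integral_linear (k τ : ℝ) : ∫ u in (0 : ℝ)..τ, k * u = k * τ ^ 2 / 2 := by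
  rw [intervalIntegral.integral_const_mul, integral_id]; ring

/-- Upper bound for `κ ψ(s) τ - φ_s(τ)`, where `ψ = φ'`, when `ψ` quadruples between `s`
and `l s`. -/
lemma mul_sub_shift_le {ψ : ℝ → ℝ} {s l κ τ : ℝ} (hmono : MonotoneOn ψ (Ici 0))
    (hnn : ∀ t > 0, 0 ≤ ψ t) (hs : 0 < s) (hl : 2 ≤ l) (hquad : 4 * ψ s ≤ ψ (l * s))
    (hκ1 : κ ≤ 1) (hτ : 0 ≤ τ) :
    κ * ψ s * τ - ∫ u in (0 : ℝ)..τ, ψ (s + u) * u / (s + u) ≤ κ ^ 2 * (l * (s * ψ s)) / 2 := by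
  have hint : ∀ a b : ℝ, 0 ≤ a → 0 ≤ b →
      IntervalIntegrable (fun u => ψ (s + u) * u / (s + u)) volume a b := fun a b ha hb =>
    ((monotoneOn_shift_integrand hmono hnn hs.le).mono fun x hx =>
      (le_min ha hb).trans hx.1).intervalIntegrable
  have ha : 0 ≤ ψ s := hnn s hs
  have hls : 0 < l * s := by positivity
  have hsmall : ∀ r : ℝ, 0 ≤ r → r ≤ l * s - s →
      κ * ψ s * r - ∫ u in (0 : ℝ)..r, ψ (s + u) * u / (s + u) ≤
        κ ^ 2 * (l * (s * ψ s)) / 2 := by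
    intro r hr hrl
    have h1 : ∫ u in (0 : ℝ)..r, (ψ s / (l * s)) * u ≤
        ∫ u in (0 : ℝ)..r, ψ (s + u) * u / (s + u) := by
      refine intervalIntegral.integral_mono_on hr
        ((continuous_const.mul continuous_id).intervalIntegrable _ _) (hint 0 r le_rfl hr) ?_
      intro u hu
      have hu0 : 0 ≤ u := hu.1
      have hψ : ψ s ≤ ψ (s + u) :=
        hmono hs.le (mem_Ici.2 (by positivity)) (by linarith)
      rw [div_mul_eq_mul_div]
      exact div_le_div₀ (mul_nonneg (ha.trans hψ) hu0)
        (mul_le_mul_of_nonneg_right hψ hu0) (by positivity) (by linarith [hu.2])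
    rw [integral_linear] at h1
    have h2 : 0 ≤ ψ s * (r - κ * (l * s)) ^ 2 / (2 * (l * s)) := by positivity
    have h3 : ψ s * (r - κ * (l * s)) ^ 2 / (2 * (l * s)) =
        ψ s / (l * s) * r ^ 2 / 2 - κ * ψ s * r + κ ^ 2 * (l * (s * ψ s)) / 2 := by
      field_simp
      ring
    linarith
  rcases le_total τ (l * s - s) with h | h
  · exact hsmall τ hτ h
  · have hR : s ≤ l * s - s := by nlinarith
    have hR0 : 0 ≤ l * s - s := by linarith
    have h1 : ∫ _u in (l * s - s)..τ, κ * ψ s ≤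
        ∫ u in (l * s - s)..τ, ψ (s + u) * u / (s + u) := by
      refine intervalIntegral.integral_mono_on h intervalIntegrable_const (hint _ _ hR0 hτ) ?_
      intro u hu
      have hu0 : s ≤ u := hR.trans hu.1
      have hψ : ψ (l * s) ≤ ψ (s + u) :=
        hmono hls.le (mem_Ici.2 (by linarith)) (by linarith [hu.1])
      have hκ : κ * ψ s ≤ ψ s := mul_le_of_le_one_left ha hκ1
      rw [le_div_iff₀ (by linarith)]
      nlinarith
    rw [intervalIntegral.integral_const, smul_eq_mul] at h1
    have h2 := intervalIntegral.integral_add_adjacent_intervals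
      (hint 0 (l * s - s) le_rfl hR0) (hint (l * s - s) τ hR0 hτ)
    have h3 := hsmall (l * s - s) hR0 le_rfl
    rw [← h2]
    linarith

/-- The value of `κ ψ(s) τ - φ_s(τ)`, where `ψ = φ'`, at `τ = κ s / (2q)` is at least
comparable to `κ² s ψ(s)`. -/
lemma le_mul_sub_shift {ψ : ℝ → ℝ} {s q κ : ℝ} (hmono : MonotoneOn ψ (Ici 0))
    (hnn : ∀ t > 0, 0 ≤ ψ t) (hs : 0 < s) (hq : 0 < q)
    (hgrow : ψ (s + s / (2 * q)) ≤ 2 * q * ψ s) (hκ0 : 0 ≤ κ) (hκ1 : κ ≤ 1) :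
    κ ^ 2 * (s * ψ s) / (4 * q) ≤ κ * ψ s * (κ * (s / (2 * q))) -
      ∫ u in (0 : ℝ)..κ * (s / (2 * q)), ψ (s + u) * u / (s + u) := by
  have hd : 0 < s / (2 * q) := by positivity
  have hτ : 0 ≤ κ * (s / (2 * q)) := by positivity
  have h1 : ∫ u in (0 : ℝ)..κ * (s / (2 * q)), ψ (s + u) * u / (s + u) ≤
      ∫ u in (0 : ℝ)..κ * (s / (2 * q)), (2 * q * ψ s / s) * u := by
    refine intervalIntegral.integral_mono_on hτ
      ((monotoneOn_shift_integrand hmono hnn hs.le).mono fun x hx =>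
        (le_min le_rfl hτ).trans hx.1).intervalIntegrable
      ((continuous_const.mul continuous_id).intervalIntegrable _ _) ?_
    intro u hu
    have hu0 : 0 ≤ u := hu.1
    have hu1 : u ≤ s / (2 * q) := hu.2.trans (mul_le_of_le_one_left hd.le hκ1)
    have hψ : ψ (s + u) ≤ 2 * q * ψ s :=
      (hmono (mem_Ici.2 (by positivity)) (mem_Ici.2 (by positivity)) (by linarith)).trans hgrow
    have hψ0 : 0 ≤ ψ (s + u) := hnn _ (by positivity)
    rw [div_mul_eq_mul_div]
    exact div_le_div₀ (mul_nonneg (hψ0.trans hψ) hu0)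
      (mul_le_mul_of_nonneg_right hψ hu0) hs (by linarith)
  rw [integral_linear] at h1
  have h2 : κ * ψ s * (κ * (s / (2 * q))) -
      2 * q * ψ s / s * (κ * (s / (2 * q))) ^ 2 / 2 = κ ^ 2 * (s * ψ s) / (4 * q) := by
    field_simp
    ring
  linarith

lemma mul_sub_shift_zero_nonpos {ψ : ℝ → ℝ} {κ τ : ℝ} (hmono : MonotoneOn ψ (Ici 0))
    (hnn : ∀ t > 0, 0 ≤ ψ t) (hκ0 : 0 ≤ κ) (hκ1 : κ ≤ 1) (hτ : 0 ≤ τ) :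
    κ * ψ 0 * τ - ∫ u in (0 : ℝ)..τ, ψ (0 + u) * u / (0 + u) ≤ 0 := by
  have h1 : ∫ _u in (0 : ℝ)..τ, κ * ψ 0 ≤ ∫ u in (0 : ℝ)..τ, ψ (0 + u) * u / (0 + u) := by
    refine intervalIntegral.integral_mono_on_of_le_Ioo hτ intervalIntegrable_const
      ((monotoneOn_shift_integrand hmono hnn le_rfl).mono fun x hx =>
        (le_min le_rfl hτ).trans hx.1).intervalIntegrable ?_
    intro u hu
    have hu0 : 0 < u := hu.1
    have hψ : ψ 0 ≤ ψ u := hmono self_mem_Ici hu0.le hu0.le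
    rw [zero_add, mul_div_cancel_right₀ _ hu0.ne']
    nlinarith [hnn u hu0]
  rw [intervalIntegral.integral_const, smul_eq_mul] at h1
  linarith


/-- for an N-function `φ` with indices `p₁ ≤ p₂` and nondecreasing
derivative, the conjugate of the shifted function satisfies
`φ_s*(κ φ'(s)) ∼ κ² φ(s)` uniformly in `κ ∈ [0,1]` and `s ≥ 0`,
with constants depending only on `p₁, p₂`. -/
theorem stmt_15 (p₁ p₂ : ℝ) (hp₁ : 1 < p₁) (hp : p₁ ≤ p₂) :
    ∃ c : ℝ, 1 ≤ c ∧
      ∀ (φ φ' : ℝ → ℝ),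
        φ 0 = 0 →
        (∀ t ∈ Set.Ici (0 : ℝ), 0 ≤ φ t) →
        (∀ t ∈ Set.Ici (0 : ℝ), HasDerivWithinAt φ (φ' t) (Set.Ici 0) t) →
        MonotoneOn φ' (Set.Ici 0) →
        (∀ t > (0 : ℝ), p₁ * φ t ≤ t * φ' t ∧ t * φ' t ≤ p₂ * φ t) →
      ∀ κ : ℝ, 0 ≤ κ → κ ≤ 1 → ∀ s ≥ (0 : ℝ),
        c⁻¹ * (κ ^ 2 * φ s) ≤
          sSup ((fun τ => κ * φ' s * τ -
            ∫ u in (0 : ℝ)..τ, φ' (s + u) * u / (s + u)) '' Set.Ici 0) ∧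
        sSup ((fun τ => κ * φ' s * τ -
            ∫ u in (0 : ℝ)..τ, φ' (s + u) * u / (s + u)) '' Set.Ici 0) ≤
          c * (κ ^ 2 * φ s) := by
  have hp₂ : 1 < p₂ := hp₁.trans_le hp
  set l : ℝ := (4 * p₂) ^ (p₁ - 1)⁻¹ + 2 with hl_def
  have hroot : 0 ≤ (4 * p₂) ^ (p₁ - 1)⁻¹ := by positivity
  have hl : 2 ≤ l := by linarith
  have hlq : 4 * p₂ ≤ l ^ (p₁ - 1) := by
    have hne : p₁ - 1 ≠ 0 := by linarith
    calc 4 * p₂ = ((4 * p₂) ^ (p₁ - 1)⁻¹) ^ (p₁ - 1) :=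
          (Real.rpow_inv_rpow (by positivity) hne).symm
      _ ≤ l ^ (p₁ - 1) := Real.rpow_le_rpow hroot (by linarith) (by linarith)
  have hlp : 0 ≤ p₂ * l := by positivity
  have hc : 1 ≤ 4 * p₂ + p₂ * l := by linarith
  refine ⟨4 * p₂ + p₂ * l, hc, ?_⟩
  intro φ φ' h0 hpos hderiv hmono hidx κ hκ0 hκ1 s hs
  have hd : ∀ t > 0, HasDerivAt φ (φ' t) t := fun t ht =>
    (hderiv t (le_of_lt ht)).hasDerivAt (Ici_mem_nhds ht)
  have hnn : ∀ t > 0, 0 ≤ φ' t := fun t ht =>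
    nonneg_of_mul_nonneg_right
      ((mul_nonneg (by linarith) (hpos t (le_of_lt ht))).trans (hidx t ht).1) ht
  rcases hs.eq_or_lt' with rfl | hs0
  · have hzero := fun τ (hτ : τ ∈ Set.Ici (0 : ℝ)) =>
      mul_sub_shift_zero_nonpos hmono hnn hκ0 hκ1 hτ
    rw [h0]
    simp only [mul_zero]
    constructor
    · refine le_csSup ⟨0, ?_⟩ ⟨0, self_mem_Ici, by simp⟩
      rintro _ ⟨τ, hτ, rfl⟩
      exact hzero τ hτ
    · refine csSup_le (nonempty_Ici.image _) ?_
      rintro _ ⟨τ, hτ, rfl⟩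
      exact hzero τ hτ
  · have hφs : 0 ≤ φ s := hpos s hs
    have hlow : φ s ≤ s * φ' s :=
      (le_mul_of_one_le_left hφs hp₁.le).trans (hidx s hs0).1
    have hup : s * φ' s ≤ p₂ * φ s := (hidx s hs0).2
    have hκφ : 0 ≤ κ ^ 2 * φ s := by positivity
    have hquad : 4 * φ' s ≤ φ' (l * s) :=
      four_mul_deriv_le hp₁ (fun t ht => hpos t (le_of_lt ht)) hd
        (fun t ht => (hidx t ht).1) hup hs0 (by linarith) hlq
    have hgrow := deriv_dilation_le hp₂ hd hmono hnn hlow (fun t ht => (hidx t ht).2) hs0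
    have hbound : (4 * p₂ + p₂ * l) * (κ ^ 2 * φ s) ∈ upperBounds
        ((fun τ => κ * φ' s * τ -
          ∫ u in (0 : ℝ)..τ, φ' (s + u) * u / (s + u)) '' Set.Ici 0) := by
      rintro _ ⟨τ, hτ, rfl⟩
      refine (mul_sub_shift_le hmono hnn hs0 hl hquad hκ1 hτ).trans ?_
      have h1 : κ ^ 2 * l * (s * φ' s) ≤ κ ^ 2 * l * (p₂ * φ s) :=
        mul_le_mul_of_nonneg_left hup (by positivity)
      have h2 : 0 ≤ p₂ * (κ ^ 2 * φ s) := by positivity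
      have h3 : 0 ≤ p₂ * l * (κ ^ 2 * φ s) := mul_nonneg hlp hκφ
      linarith
    constructor
    · refine le_trans ?_ (le_csSup ⟨_, hbound⟩
        ⟨κ * (s / (2 * p₂)), mem_Ici.2 (by positivity), rfl⟩)
      refine le_trans ?_ (le_mul_sub_shift hmono hnn hs0 (by linarith) hgrow hκ0 hκ1)
      rw [inv_mul_eq_div]
      exact div_le_div₀ (by have := hnn s hs0; positivity)
        (mul_le_mul_of_nonneg_left hlow (by positivity)) (by positivity) (by linarith)
    · exact csSup_le (nonempty_Ici.image _) hbound
end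

section
/- Let φ : [0,∞) → [0,∞) be differentiable with derivative φ', with φ(0) = 0, and let 1 < p₁ ≤ p₂ be such that p₁·φ(t) ≤ t·φ'(t) ≤ p₂·φ(t) for all t > 0. Define the conjugate φ*(t) = sup_{s ≥ 0} (s·t − φ(s)). Then for every C > 0 and every t ≥ 0: min{C^{p₁/(p₁−1)}, C^{p₂/(p₂−1)}}·φ*(t) ≤ φ*(C·t) ≤ max{C^{p₁/(p₁−1)}, C^{p₂/(p₂−1)}}·φ*(t). -/
open Set

section Scaling

variable {φ φ' : ℝ → ℝ}

theorem hasDerivAt_mul_rpow_neg (hder : ∀ t ∈ Ici (0 : ℝ), HasDerivWithinAt φ (φ' t) (Ici 0) t)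
    (p : ℝ) {t : ℝ} (ht : 0 < t) :
    HasDerivAt (fun s => φ s * s ^ (-p)) ((t * φ' t - p * φ t) * t ^ (-p - 1)) t := by
  have h₁ : HasDerivAt φ (φ' t) t := (hder t ht.le).hasDerivAt (Ici_mem_nhds ht)
  have h₂ := h₁.mul (Real.hasDerivAt_rpow_const (p := -p) (Or.inl ht.ne'))
  refine h₂.congr_deriv ?_
  have h₃ : t ^ (-p) = t ^ (-p - 1) * t := by
    rw [← Real.rpow_add_one ht.ne']
    ring_nf
  rw [h₃]
  ring

theorem rpow_mul_le_of_mul_rpow_neg_le {p l r : ℝ} (hl : 0 < l) (hr : 0 < r)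
    (h : φ r * r ^ (-p) ≤ φ (l * r) * (l * r) ^ (-p)) : l ^ p * φ r ≤ φ (l * r) := by
  rw [Real.mul_rpow hl.le hr.le, ← mul_assoc] at h
  have h' := le_of_mul_le_mul_right h (Real.rpow_pos_of_pos hr _)
  rwa [Real.rpow_neg hl.le, ← div_eq_mul_inv, le_div_iff₀ (Real.rpow_pos_of_pos hl _),
    mul_comm] at h'

/-- A lower index bound gives growth of power type under dilation. -/
theorem rpow_mul_le_of_one_le (hφ0 : φ 0 = 0)
    (hder : ∀ t ∈ Ici (0 : ℝ), HasDerivWithinAt φ (φ' t) (Ici 0) t) {p : ℝ}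
    (hidx : ∀ t > (0 : ℝ), p * φ t ≤ t * φ' t) {l r : ℝ} (hl : 1 ≤ l) (hr : 0 ≤ r) :
    l ^ p * φ r ≤ φ (l * r) := by
  rcases hr.eq_or_lt with rfl | hr
  · simp [hφ0]
  have hl0 : 0 < l := zero_lt_one.trans_le hl
  have hmono : MonotoneOn (fun s => φ s * s ^ (-p)) (Ioi 0) := by
    refine monotoneOn_of_hasDerivWithinAt_nonneg (convex_Ioi 0)
      (fun t ht => (hasDerivAt_mul_rpow_neg hder p ht).continuousAt.continuousWithinAt)
      (fun t ht => (hasDerivAt_mul_rpow_neg hder p (interior_subset ht)).hasDerivWithinAt)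
      (fun t ht => ?_)
    have ht : 0 < t := interior_subset ht
    exact mul_nonneg (sub_nonneg.2 (hidx t ht)) (Real.rpow_nonneg ht.le _)
  exact rpow_mul_le_of_mul_rpow_neg_le hl0 hr
    (hmono hr (mul_pos hl0 hr) (le_mul_of_one_le_left hr.le hl))

/-- An upper index bound controls the decay under contraction. -/
theorem rpow_mul_le_of_le_one (hφ0 : φ 0 = 0)
    (hder : ∀ t ∈ Ici (0 : ℝ), HasDerivWithinAt φ (φ' t) (Ici 0) t) {p : ℝ}
    (hidx : ∀ t > (0 : ℝ), t * φ' t ≤ p * φ t) {l r : ℝ} (hl0 : 0 < l) (hl : l ≤ 1)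
    (hr : 0 ≤ r) : l ^ p * φ r ≤ φ (l * r) := by
  rcases hr.eq_or_lt with rfl | hr
  · simp [hφ0]
  have hanti : AntitoneOn (fun s => φ s * s ^ (-p)) (Ioi 0) := by
    refine antitoneOn_of_hasDerivWithinAt_nonpos (convex_Ioi 0)
      (fun t ht => (hasDerivAt_mul_rpow_neg hder p ht).continuousAt.continuousWithinAt)
      (fun t ht => (hasDerivAt_mul_rpow_neg hder p (interior_subset ht)).hasDerivWithinAt)
      (fun t ht => ?_)
    have ht : 0 < t := interior_subset ht
    exact mul_nonpos_of_nonpos_of_nonneg (sub_nonpos.2 (hidx t ht)) (Real.rpow_nonneg ht.le _)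
  exact rpow_mul_le_of_mul_rpow_neg_le hl0 hr
    (hanti (mul_pos hl0 hr) hr (mul_le_of_le_one_left hr.le hl))

theorem rpow_one_div_mul_self {C p : ℝ} (hC : 0 < C) (hp : 1 < p) :
    C ^ (1 / (p - 1)) * C = C ^ (p / (p - 1)) := by
  have : p - 1 ≠ 0 := (sub_pos.2 hp).ne'
  rw [← Real.rpow_add_one hC.ne']
  congr 1
  field_simp
  ring

theorem rpow_one_div_rpow {C p : ℝ} (hC : 0 < C) :
    (C ^ (1 / (p - 1))) ^ p = C ^ (p / (p - 1)) := by
  rw [← Real.rpow_mul hC.le, one_div_mul_eq_div]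

/-- The dilation factor `l` matching a dilation by `C` on the conjugate side. -/
theorem exists_dilation (hφ0 : φ 0 = 0)
    (hder : ∀ t ∈ Ici (0 : ℝ), HasDerivWithinAt φ (φ' t) (Ici 0) t) {p₁ p₂ : ℝ}
    (hp₁ : 1 < p₁) (hp : p₁ ≤ p₂)
    (hidx : ∀ t > (0 : ℝ), p₁ * φ t ≤ t * φ' t ∧ t * φ' t ≤ p₂ * φ t) {C : ℝ} (hC : 0 < C) :
    ∃ l > 0, l * C ≤ max (C ^ (p₁ / (p₁ - 1))) (C ^ (p₂ / (p₂ - 1))) ∧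
      ∀ r ≥ 0, l * C * φ r ≤ φ (l * r) := by
  have hp₂ : 1 < p₂ := hp₁.trans_le hp
  rcases le_total 1 C with h | h
  · refine ⟨C ^ (1 / (p₁ - 1)), Real.rpow_pos_of_pos hC _, ?_, fun r hr => ?_⟩
    · rw [rpow_one_div_mul_self hC hp₁]
      exact le_max_left _ _
    · rw [rpow_one_div_mul_self hC hp₁, ← rpow_one_div_rpow hC]
      exact rpow_mul_le_of_one_le hφ0 hder (fun t ht => (hidx t ht).1)
        (Real.one_le_rpow h (one_div_nonneg.2 (sub_pos.2 hp₁).le)) hr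
  · refine ⟨C ^ (1 / (p₂ - 1)), Real.rpow_pos_of_pos hC _, ?_, fun r hr => ?_⟩
    · rw [rpow_one_div_mul_self hC hp₂]
      exact le_max_right _ _
    · rw [rpow_one_div_mul_self hC hp₂, ← rpow_one_div_rpow hC]
      exact rpow_mul_le_of_le_one hφ0 hder (fun t ht => (hidx t ht).2)
        (Real.rpow_pos_of_pos hC _)
        (Real.rpow_le_one hC.le h (one_div_nonneg.2 (sub_pos.2 hp₂).le)) hr

theorem mul_mem_upperBounds_of_dilation {C l t b : ℝ} (hC : 0 < C) (hl : 0 < l)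
    (h : ∀ r ≥ 0, l * C * φ r ≤ φ (l * r))
    (hb : b ∈ upperBounds ((fun s => s * t - φ s) '' Ici 0)) :
    l * C * b ∈ upperBounds ((fun s => s * (C * t) - φ s) '' Ici 0) := by
  rintro _ ⟨s, hs, rfl⟩
  have hr : 0 ≤ s / l := div_nonneg hs hl.le
  have h₁ : s / l * t - φ (s / l) ≤ b := hb (mem_image_of_mem _ hr)
  have h₂ := h _ hr
  rw [mul_div_cancel₀ _ hl.ne'] at h₂
  have h₃ := mul_le_mul_of_nonneg_left h₁ (mul_pos hl hC).le
  have h₄ : l * C * (s / l * t - φ (s / l)) = s * (C * t) - l * C * φ (s / l) := by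
    field_simp
  change s * (C * t) - φ s ≤ l * C * b
  linarith

/-- The upper scaling inequality for the conjugate. -/
theorem sSup_conjugate_dilation_le (hφ0 : φ 0 = 0)
    (hder : ∀ t ∈ Ici (0 : ℝ), HasDerivWithinAt φ (φ' t) (Ici 0) t) {p₁ p₂ : ℝ}
    (hp₁ : 1 < p₁) (hp : p₁ ≤ p₂)
    (hidx : ∀ t > (0 : ℝ), p₁ * φ t ≤ t * φ' t ∧ t * φ' t ≤ p₂ * φ t) {C : ℝ} (hC : 0 < C)
    (t : ℝ) :
    sSup ((fun s => s * (C * t) - φ s) '' Ici 0) ≤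
      max (C ^ (p₁ / (p₁ - 1))) (C ^ (p₂ / (p₂ - 1))) *
        sSup ((fun s => s * t - φ s) '' Ici 0) := by
  by_cases hbdd : BddAbove ((fun s => s * t - φ s) '' Ici 0)
  · obtain ⟨l, hl, hle, h⟩ := exists_dilation hφ0 hder hp₁ hp hidx hC
    have hnonneg : 0 ≤ sSup ((fun s => s * t - φ s) '' Ici 0) :=
      le_csSup hbdd ⟨0, self_mem_Ici, by simp [hφ0]⟩
    refine (csSup_le (nonempty_Ici.image _) ?_).trans (mul_le_mul_of_nonneg_right hle hnonneg)
    exact mul_mem_upperBounds_of_dilation hC hl h fun _ hx => le_csSup hbdd hx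
  · have hbdd' : ¬ BddAbove ((fun s => s * (C * t) - φ s) '' Ici 0) := by
      rintro ⟨b, hb⟩
      obtain ⟨l, hl, -, h⟩ := exists_dilation hφ0 hder hp₁ hp hidx (inv_pos.2 hC)
      have := mul_mem_upperBounds_of_dilation (inv_pos.2 hC) hl h hb
      rw [inv_mul_cancel_left₀ hC.ne'] at this
      exact hbdd ⟨_, this⟩
    rw [Real.sSup_of_not_bddAbove hbdd, Real.sSup_of_not_bddAbove hbdd', mul_zero]

end Scaling


/-- for an N-function `φ` with indices `p₁ ≤ p₂`, the conjugate `φ*`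
satisfies the scaling inequalities
`min{C^{p₁/(p₁−1)}, C^{p₂/(p₂−1)}} φ*(t) ≤ φ*(Ct) ≤ max{C^{p₁/(p₁−1)}, C^{p₂/(p₂−1)}} φ*(t)`. -/
theorem stmt_18 (φ φ' : ℝ → ℝ) (p₁ p₂ : ℝ) (hp₁ : 1 < p₁) (hp : p₁ ≤ p₂)
    (hφ0 : φ 0 = 0)
    (hφpos : ∀ t ∈ Set.Ici (0 : ℝ), 0 ≤ φ t)
    (hder : ∀ t ∈ Set.Ici (0 : ℝ), HasDerivWithinAt φ (φ' t) (Set.Ici 0) t)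
    (hidx : ∀ t > (0 : ℝ), p₁ * φ t ≤ t * φ' t ∧ t * φ' t ≤ p₂ * φ t)
    (φstar : ℝ → ℝ)
    (hφstar : ∀ t, φstar t = sSup ((fun s => s * t - φ s) '' Set.Ici 0)) :
    ∀ C > (0 : ℝ), ∀ t ≥ (0 : ℝ),
      min (C ^ (p₁ / (p₁ - 1))) (C ^ (p₂ / (p₂ - 1))) * φstar t ≤ φstar (C * t) ∧
      φstar (C * t) ≤ max (C ^ (p₁ / (p₁ - 1))) (C ^ (p₂ / (p₂ - 1))) * φstar t := by
  intro C hC t _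
  have hupper : ∀ D > (0 : ℝ), ∀ u,
      φstar (D * u) ≤ max (D ^ (p₁ / (p₁ - 1))) (D ^ (p₂ / (p₂ - 1))) * φstar u := by
    intro D hD u
    rw [hφstar, hφstar]
    exact sSup_conjugate_dilation_le hφ0 hder hp₁ hp hidx hD u
  refine ⟨?_, hupper C hC t⟩
  have h := hupper C⁻¹ (inv_pos.2 hC) (C * t)
  rw [inv_mul_cancel_left₀ hC.ne', Real.inv_rpow hC.le, Real.inv_rpow hC.le] at h
  have ha := Real.rpow_pos_of_pos hC (p₁ / (p₁ - 1))
  have hb := Real.rpow_pos_of_pos hC (p₂ / (p₂ - 1))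
  generalize C ^ (p₁ / (p₁ - 1)) = a at *
  generalize C ^ (p₂ / (p₂ - 1)) = b at *
  have hmax : max a⁻¹ b⁻¹ = (min a b)⁻¹ := by
    rcases le_total a b with hab | hab
    · rw [min_eq_left hab, max_eq_left (inv_anti₀ ha hab)]
    · rw [min_eq_right hab, max_eq_right (inv_anti₀ hb hab)]
  rwa [hmax, le_inv_mul_iff₀ (lt_min ha hb)] at h
end
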